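/- Let k be an algebraically closed field and let S = V(f) ⊆ P³ be a smooth surface of degree d ≥ 3 containing exactly d²(d²−3d+3) lines. Then every triple L₁, L₂, L₃ of pairwise skew lines on S extends to a quadric configuration: there exist lines L₄,…,L_d and M₁,…,M_d on S such that L₁,…,L_d are pairwise skew, M₁,…,M_d are pairwise skew, every Lᵢ meets every Mⱼ, and moreover every line on S that meets all of L₁, L₂, L₃ is equal to one of M₁,…,M_d. -/

import Mathlib

open MvPolynomial

/-- `W` is a line (2-dimensional linear subspace of `k⁴`) lying on the surface `V(f) ⊆ P³`. -/
def IsLineOn {k : Type*} [Field k] (f : MvPolynomial (Fin 4) k)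
    (W : Submodule k (Fin 4 → k)) : Prop :=
  Module.finrank k W = 2 ∧ ∀ v ∈ W, MvPolynomial.eval v f = 0

/-- `f` is a nonzero homogeneous polynomial of degree `d` in `k[x,y,z,w]` such that `f` and its
four partial derivatives have no common zero in `k⁴ ∖ {0}`; i.e. `V(f) ⊆ P³` is a smooth
surface of degree `d`. -/
def IsSmoothSurface {k : Type*} [Field k] (f : MvPolynomial (Fin 4) k) (d : ℕ) : Prop :=
  f ≠ 0 ∧ f.IsHomogeneous d ∧
    ∀ v : Fin 4 → k, v ≠ 0 →
      ¬ (MvPolynomial.eval v f = 0 ∧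
         ∀ i : Fin 4, MvPolynomial.eval v (MvPolynomial.pderiv i f) = 0)

/-- Lowest lexicographic exponent of a relation specialised along a chain of primes. -/
theorem exists_lowest_exponent {R : Type*} [CommRing R] (n : ℕ) (B : Finset (Fin n → ℕ))
    (hB : B.Nonempty) :
    ∃ β ∈ B, ∀ (p : (Fin n → ℕ) → R) (g : ℕ → R) (P : ℕ → Ideal R),
      (∀ i ≤ n, (P i).IsPrime) → (∀ i < n, P i ≤ P (i + 1)) → (∀ i < n, g i ∉ P i) →
      (∀ i < n, g i ∈ P (i + 1)) → ∑ b ∈ B, p b * ∏ j : Fin n, g j ^ b j ∈ P 0 → p β ∈ P n := by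
  induction n with
  | zero =>
    obtain ⟨β, hβ⟩ := hB
    refine ⟨β, hβ, fun p g P _ _ _ _ h ↦ ?_⟩
    have : B = {β} := by
      ext x; simp [Subsingleton.elim x β, hβ]
    simpa [this] using h
  | succ n ih =>
    obtain ⟨b₀, hb₀, hmin⟩ := Finset.exists_min_image B (fun b ↦ b 0) hB
    set e := b₀ 0 with he
    set B₀ := B.filter (fun b ↦ b 0 = e) with hB₀
    have htail : Set.InjOn (Fin.tail : (Fin (n + 1) → ℕ) → (Fin n → ℕ)) B₀ := by
      intro x hx y hy hxy
      simp only [hB₀, Finset.coe_filter, Set.mem_ofPred_eq] at hx hy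
      rw [← Fin.cons_self_tail x, ← Fin.cons_self_tail y, hx.2, hy.2, hxy]
    obtain ⟨β, hβ, H⟩ := ih (B₀.image Fin.tail)
      ⟨Fin.tail b₀, Finset.mem_image_of_mem _ (by simp [hB₀, hb₀, he])⟩
    obtain ⟨b, hb, rfl⟩ := Finset.mem_image.1 hβ
    have hb' : b ∈ B ∧ b 0 = e := by simpa [hB₀] using hb
    refine ⟨b, hb'.1, fun p g P hP hle hg hg' hsum ↦ ?_⟩
    have key := H (fun b' ↦ p (Fin.cons e b')) (fun i ↦ g (i + 1)) (fun i ↦ P (i + 1))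
      (fun i hi ↦ hP _ (by omega)) (fun i hi ↦ hle _ (by omega)) (fun i hi ↦ hg _ (by omega))
      (fun i hi ↦ hg' _ (by omega)) ?_
    · simpa [← hb'.2] using key
    · rw [Finset.sum_image htail]
      have h1 : ∑ b ∈ B, p b * (g 0 ^ (b 0 - e) * ∏ j : Fin n, g (j + 1) ^ b j.succ) ∈ P 0 := by
        have := hP 0 (by omega)
        refine ((this.mem_or_mem (x := g 0 ^ e) (y := _) ?_).resolve_left
          fun h ↦ hg 0 (by omega) (this.mem_of_pow_mem _ h))
        convert hsum using 1
        rw [Finset.mul_sum]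
        refine Finset.sum_congr rfl fun x hx ↦ ?_
        have : e ≤ x 0 := hmin x hx
        rw [Fin.prod_univ_succ]
        simp only [Fin.val_zero, Fin.val_succ]
        rw [← Nat.add_sub_cancel' this, pow_add]
        simp only [Nat.add_sub_cancel' this]
        ring
      have h2 := hle 0 (by omega) h1
      rw [← Finset.sum_filter_add_sum_filter_not B (fun b ↦ b 0 = e)] at h2
      have h3 : ∑ b ∈ B.filter (fun b ↦ ¬ b 0 = e),
          p b * (g 0 ^ (b 0 - e) * ∏ j : Fin n, g (j + 1) ^ b j.succ) ∈ P (0 + 1) := by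
        refine Ideal.sum_mem _ fun x hx ↦ ?_
        rw [Finset.mem_filter] at hx
        have : e ≤ x 0 := hmin x hx.1
        refine Ideal.mul_mem_left _ _ (Ideal.mul_mem_right _ _ ?_)
        exact Ideal.pow_mem_of_mem _ (hg' 0 (by omega)) _ (by have := hx.2; omega)
      have h4 := (Ideal.add_mem_iff_left _ h3).1 h2
      convert h4 using 1
      refine Finset.sum_congr rfl fun x hx ↦ ?_
      rw [Finset.mem_filter] at hx
      rw [← hx.2]
      simp [Fin.cons_self_tail, Fin.tail]

/-- The exponent vectors of total degree at most `N`. -/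
def exponentsLE (n N : ℕ) : Finset (Fin n → ℕ) :=
  (Fintype.piFinset fun _ ↦ Finset.range (N + 1)).filter fun b ↦ ∑ i, b i ≤ N

theorem mem_exponentsLE {n N : ℕ} {b : Fin n → ℕ} : b ∈ exponentsLE n N ↔ ∑ i, b i ≤ N := by
  simp only [exponentsLE, Finset.mem_filter, Fintype.mem_piFinset, Finset.mem_range,
    and_iff_right_iff_imp]
  intro h i
  have := Finset.single_le_sum (f := b) (fun _ _ ↦ Nat.zero_le _) (Finset.mem_univ i)
  omega

theorem card_exponentsLE_le (n N : ℕ) : (exponentsLE n N).card ≤ (N + 1) ^ n :=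
  (Finset.card_filter_le _ _).trans (by simp)

theorem exists_card_exponentsLE_lt (n s c : ℕ) (hs : 2 ≤ s) :
    ∃ B, (exponentsLE n (s * B + c)).card < (s ^ n + 1) * (exponentsLE n B).card := by
  by_contra! h
  let b : ℕ → ℕ := fun m ↦ Nat.rec 0 (fun _ x ↦ s * x + c) m
  have hb : ∀ m, b (m + 1) = s * b m + c := fun m ↦ rfl
  have hlow : ∀ m, (s ^ n + 1) ^ m ≤ (exponentsLE n (b m)).card := by
    intro m
    induction m with
    | zero => simpa using ⟨fun _ ↦ 0, mem_exponentsLE.2 (by simp)⟩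
    | succ m ih => rw [hb, pow_succ']; exact (Nat.mul_le_mul_left _ ih).trans (h _)
  have hup : ∀ m, b m + c ≤ c * s ^ m := by
    intro m
    induction m with
    | zero => simp [b]
    | succ m ih => rw [hb, pow_succ]; nlinarith
  have hall : ∀ m, (s ^ n + 1) ^ m ≤ (c + 1) ^ n * (s ^ n) ^ m := by
    intro m
    refine (hlow m).trans ((card_exponentsLE_le _ _).trans ?_)
    rw [← pow_mul, mul_comm n m, pow_mul, ← mul_pow]
    refine Nat.pow_le_pow_left ?_ _
    have := hup m
    have := Nat.one_le_pow m s (by omega)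
    nlinarith
  have hpos : (0 : ℝ) < (s : ℝ) ^ n := by positivity
  obtain ⟨m, hm⟩ := pow_unbounded_of_one_lt ((c + 1 : ℝ) ^ n)
    (show (1 : ℝ) < ((s : ℝ) ^ n + 1) / (s : ℝ) ^ n by rw [one_lt_div hpos]; linarith)
  rw [div_pow, lt_div_iff₀ (by positivity)] at hm
  have := hall m
  have : ((s : ℝ) ^ n + 1) ^ m ≤ (c + 1 : ℝ) ^ n * ((s : ℝ) ^ n) ^ m := by exact_mod_cast this
  linarith

theorem finrank_restrictTotalDegree_le (k : Type*) [Field k] (n N : ℕ) :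
    Module.finrank k (restrictTotalDegree (Fin n) k N) ≤ (exponentsLE n N).card := by
  classical
  rw [restrictTotalDegree, restrictSupport_eq_span]
  have : (fun s : Fin n →₀ ℕ ↦ monomial s (1 : k)) '' {m | (m.sum fun _ e ↦ e) ≤ N} =
      ((exponentsLE n N).image fun b ↦ monomial (Finsupp.equivFunOnFinite.symm b) (1 : k) :
        Finset (MvPolynomial (Fin n) k)) := by
    ext q
    simp only [Set.mem_image, Set.mem_ofPred_eq, Finset.coe_image, Finset.mem_coe, mem_exponentsLE]
    constructor
    · rintro ⟨m, hm, rfl⟩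
      refine ⟨m, ?_, by congr 2; ext; simp⟩
      rwa [Finsupp.sum_fintype _ _ (by simp)] at hm
    · rintro ⟨b, hb, rfl⟩
      refine ⟨_, ?_, rfl⟩
      rw [Finsupp.sum_fintype _ _ (by simp)]
      simpa using hb
  have h2 := finrank_span_finset_le_card (R := k)
    ((exponentsLE n N).image fun b ↦ monomial (Finsupp.equivFunOnFinite.symm b) (1 : k))
  rw [this]
  exact h2.trans Finset.card_image_le

theorem exists_algebraic_relation {k : Type*} [Field k] (n s : ℕ) (hs : 2 ≤ s)
    (g : ℕ → MvPolynomial (Fin n) k) (hg : ∀ i, (g i).totalDegree ≤ s)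
    (l : MvPolynomial (Fin n) k) (hl : l.totalDegree ≤ 1) :
    ∃ (B : Finset (Fin n → ℕ)) (p : (Fin n → ℕ) → Polynomial k), B.Nonempty ∧
      (∀ b ∈ B, p b ≠ 0) ∧ (∀ b, (p b).natDegree ≤ s ^ n) ∧
      ∑ b ∈ B, Polynomial.aeval l (p b) * ∏ j : Fin n, g j ^ b j = 0 := by
  classical
  obtain ⟨D, hD⟩ := exists_card_exponentsLE_lt n s (s ^ n) hs
  let ι := Fin (s ^ n + 1) × exponentsLE n D
  let v : ι → restrictTotalDegree (Fin n) k (s * D + s ^ n) := fun x ↦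
    ⟨l ^ (x.1 : ℕ) * ∏ j : Fin n, g j ^ x.2.1 j, by
      rw [mem_restrictTotalDegree]
      refine (totalDegree_mul _ _).trans ?_
      have h1 : (l ^ (x.1 : ℕ)).totalDegree ≤ s ^ n := by
        refine (totalDegree_pow _ _).trans ?_
        have := x.1.2
        nlinarith
      have h2 : (∏ j : Fin n, g j ^ x.2.1 j).totalDegree ≤ s * D := by
        refine (totalDegree_finsetProd _ _).trans ?_
        calc ∑ j : Fin n, (g j ^ x.2.1 j).totalDegree ≤ ∑ j : Fin n, s * x.2.1 j := by
              refine Finset.sum_le_sum fun j _ ↦ (totalDegree_pow _ _).trans ?_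
              rw [mul_comm]; exact Nat.mul_le_mul_right _ (hg _)
          _ ≤ s * D := by
              rw [← Finset.mul_sum]
              exact Nat.mul_le_mul_left _ (mem_exponentsLE.1 x.2.2)
      omega⟩
  have hdep : ¬ LinearIndependent k v := by
    intro h
    have := h.fintype_card_le_finrank
    have h3 := finrank_restrictTotalDegree_le k n (s * D + s ^ n)
    simp only [ι, Fintype.card_prod, Fintype.card_fin, Fintype.card_coe] at this
    omega
  obtain ⟨c, hc, x, hx⟩ := Fintype.not_linearIndependent_iff.1 hdep
  let p : (Fin n → ℕ) → Polynomial k := fun b ↦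
    if hb : b ∈ exponentsLE n D then ∑ i : Fin (s ^ n + 1), Polynomial.monomial i (c (i, ⟨b, hb⟩))
    else 0
  have hcoeff : ∀ (i : Fin (s ^ n + 1)) b (hb : b ∈ exponentsLE n D),
      (p b).coeff i = c (i, ⟨b, hb⟩) := by
    intro i b hb
    simp only [p, hb, dif_pos, Polynomial.finsetSum_coeff, Polynomial.coeff_monomial]
    simp [Fin.val_inj]
  have hsum : ∑ b ∈ exponentsLE n D, Polynomial.aeval l (p b) * ∏ j : Fin n, g j ^ b j = 0 := by
    have := congrArg Subtype.val hc
    simp only [ZeroMemClass.coe_zero, AddSubmonoidClass.coe_finsetSum, ι,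
      Fintype.sum_prod_type_right, v, SetLike.val_smul] at this
    rw [← Finset.sum_coe_sort (exponentsLE n D), ← this]
    refine Finset.sum_congr rfl fun b _ ↦ ?_
    simp only [p, b.2, dif_pos, map_sum, Polynomial.aeval_monomial, Finset.sum_mul]
    refine Finset.sum_congr rfl fun i _ ↦ ?_
    rw [Algebra.smul_def, mul_assoc]
  refine ⟨(exponentsLE n D).filter (fun b ↦ p b ≠ 0), p, ?_, ?_, ?_, ?_⟩
  · refine ⟨x.2.1, Finset.mem_filter.2 ⟨x.2.2, fun h0 ↦ hx ?_⟩⟩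
    have := hcoeff x.1 x.2.1 x.2.2
    rw [h0] at this
    simpa using this.symm
  · simp
  · intro b
    by_cases hb : b ∈ exponentsLE n D
    · simp only [p, hb, dif_pos]
      refine Polynomial.natDegree_sum_le_of_forall_le _ _ fun i _ ↦ ?_
      exact (Polynomial.natDegree_monomial_le _).trans (by have := i.2; omega)
    · simp [p, hb]
  · rw [← hsum]
    refine Finset.sum_subset (Finset.filter_subset _ _) fun b hb hb' ↦ ?_
    have : p b = 0 := by simpa [hb] using hb'
    simp [this]

theorem aeval_eq_eval_apply {k σ : Type*} [CommRing k] (z : σ → k) (q : MvPolynomial σ k) :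
    aeval z q = eval z q := by
  rw [← coe_aeval_eq_eval]; rfl

theorem le_height_vanishingIdeal_singleton {k : Type*} [Field k] (n : ℕ) (z : Fin n → k) :
    (n : ℕ∞) ≤ (vanishingIdeal k {z} : Ideal (MvPolynomial (Fin n) k)).height := by
  classical
  let φ : ℕ → MvPolynomial (Fin n) k →ₐ[k] MvPolynomial (Fin n) k := fun i ↦
    aeval fun j ↦ if (j : ℕ) < i then C (z j) else X j
  have hφ : ∀ i p, φ (i + 1) (φ i p) = φ (i + 1) p := by
    intro i p
    have h : (φ (i + 1)).comp (φ i) = φ (i + 1) := by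
      refine algHom_ext fun j ↦ ?_
      rw [AlgHom.comp_apply]
      simp only [φ, aeval_X]
      by_cases hj : (j : ℕ) < i
      · simp [hj, Nat.lt_succ_of_lt hj, algHom_C, algebraMap_eq]
      · simp [hj]
    rw [← AlgHom.comp_apply, h]
  have hle : ∀ i ≤ n, (i : ℕ∞) ≤ (RingHom.ker (φ i)).height := by
    intro i
    induction i with
    | zero => simp
    | succ i ih =>
      intro hi
      have hlt : RingHom.ker (φ i) < RingHom.ker (φ (i + 1)) := by
        refine lt_of_le_of_ne (fun p hp ↦ ?_) fun h ↦ ?_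
        · rw [RingHom.mem_ker] at hp ⊢
          rw [← hφ, hp, map_zero]
        · have hmem : X ⟨i, hi⟩ - C (z ⟨i, hi⟩) ∈ RingHom.ker (φ (i + 1)) := by
            simp [RingHom.mem_ker, φ, algHom_C]
          rw [← h, RingHom.mem_ker] at hmem
          simp only [φ, map_sub, aeval_X, lt_irrefl, if_false, algHom_C, algebraMap_eq] at hmem
          have := congrArg (eval fun _ ↦ z ⟨i, hi⟩ + 1) hmem
          simp at this
      have := RingHom.ker_isPrime (φ i)
      have := RingHom.ker_isPrime (φ (i + 1))
      push_cast
      exact (add_le_add_left (ih (by omega)) 1).trans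
        (Ideal.height_add_one_le_of_lt_of_isPrime hlt)
  refine (hle n le_rfl).trans (le_of_eq ?_)
  congr 1
  ext p
  have : φ n = (Algebra.ofId k (MvPolynomial (Fin n) k)).comp (aeval z) :=
    algHom_ext fun j ↦ by simp [φ, Algebra.ofId_apply, algebraMap_eq]
  rw [RingHom.mem_ker, this, mem_vanishingIdeal_singleton_iff]
  simp [Algebra.ofId_apply, algebraMap_eq]

theorem exists_chain_minimalPrimes {R : Type*} [CommRing R] (J : ℕ → Ideal R) (n : ℕ)
    (m : Ideal R) (hm : m.IsPrime) (hJ : ∀ i < n, J i ≤ m) (hmono : Monotone J) :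
    ∃ P : ℕ → Ideal R, P n = m ∧ (∀ i ≤ n, (P i).IsPrime) ∧
      ∀ i < n, P i ∈ (J i).minimalPrimes ∧ P i ≤ P (i + 1) := by
  induction n generalizing m with
  | zero => exact ⟨fun _ ↦ m, rfl, fun _ _ ↦ hm, by simp⟩
  | succ n ih =>
    obtain ⟨p, hp, hpm⟩ := Ideal.exists_minimalPrimes_le (hJ n (by omega))
    obtain ⟨P, hPn, hprime, hP⟩ := ih p hp.1.1 fun i hi ↦ (hmono hi.le).trans hp.1.2
    refine ⟨fun i ↦ if i ≤ n then P i else m, by simp, fun i hi ↦ ?_, fun i hi ↦ ?_⟩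
    · dsimp only
      split_ifs with h
      exacts [hprime i h, hm]
    · have hi' : i ≤ n := by omega
      rcases hi'.lt_or_eq with h | rfl
      · simpa [hi', Nat.succ_le_of_lt h] using hP i h
      · simpa [hPn, hpm] using hp

theorem vanishingIdeal_singleton_le_of_finite_zeroLocus {k : Type*} [Field k] [IsAlgClosed k]
    {n : ℕ} (p : Ideal (MvPolynomial (Fin n) k)) [hp : p.IsPrime] (z : Fin n → k)
    (hz : p ≤ vanishingIdeal k {z}) (hfin : (zeroLocus k p).Finite) :
    vanishingIdeal k {z} ≤ p := by
  have hinf : hfin.toFinset.inf (fun x ↦ (vanishingIdeal k {x} : Ideal (MvPolynomial (Fin n) k)))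
      ≤ p := by
    intro q hq
    rw [← IsPrime.vanishingIdeal_zeroLocus (K := k) p, mem_vanishingIdeal_iff]
    intro x hx
    have := (Finset.inf_le (f := fun x ↦ (vanishingIdeal k {x} : Ideal (MvPolynomial (Fin n) k)))
      (hfin.mem_toFinset.2 hx)) hq
    simpa using this
  obtain ⟨x, -, hx⟩ := hp.inf_le'.1 hinf
  have hmax : (vanishingIdeal k {x} : Ideal (MvPolynomial (Fin n) k)).IsMaximal := inferInstance
  have hprime : (vanishingIdeal k {z} : Ideal (MvPolynomial (Fin n) k)).IsPrime := inferInstance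
  exact (hmax.eq_of_le hprime.ne_top (hx.trans hz)) ▸ hx

theorem exists_mem_forall_notMem_minimalPrimes {k R : Type*} [Field k] [Infinite k] [CommRing R]
    [IsNoetherianRing R] [Algebra k R] (W : Submodule k R) (J : Ideal R) :
    ∃ g ∈ W, ∀ p ∈ J.minimalPrimes, (∃ w ∈ W, w ∉ p) → g ∉ p := by
  let ι := {p : Ideal R // p ∈ J.minimalPrimes ∧ ∃ w ∈ W, w ∉ p}
  have := (Ideal.finite_minimalPrimes_of_isNoetherianRing R J).to_subtype
  have : Finite ι := Finite.of_injective (β := J.minimalPrimes) (fun p ↦ ⟨p.1, p.2.1⟩)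
    fun p q h ↦ Subtype.ext (Subtype.mk.inj h)
  obtain ⟨x, hx⟩ := Submodule.exists_forall_notMem_of_forall_ne_top
    (fun i : ι ↦ ((i.1.restrictScalars k).comap W.subtype)) fun i h ↦ by
      obtain ⟨w, hw, hwi⟩ := i.2.2
      have : (⟨w, hw⟩ : W) ∈ (i.1.restrictScalars k).comap W.subtype := h ▸ Submodule.mem_top
      exact hwi (by simpa using this)
  exact ⟨x, x.2, fun p hp hw h ↦ hx ⟨p, hp, hw⟩ (by simpa using h)⟩

theorem exists_linear_injOn {k : Type*} [Field k] [Infinite k] {n : ℕ} (Z : Set (Fin n → k))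
    (hZ : Z.Finite) :
    ∃ l : MvPolynomial (Fin n) k, l.totalDegree ≤ 1 ∧ Z.InjOn fun z ↦ eval z l := by
  have := hZ.to_subtype
  obtain ⟨φ, hφ⟩ := Module.exists_dual_forall_apply_ne_zero (K := k)
    (fun x : {x : Z × Z // x.1 ≠ x.2} ↦ (x.1.1 : Fin n → k) - x.1.2)
    fun x h ↦ x.2 (Subtype.ext (sub_eq_zero.1 h))
  refine ⟨∑ i, C (φ (Pi.single i 1)) * X i, ?_, fun x hx y hy hxy ↦ ?_⟩
  · refine totalDegree_finsetSum_le fun i _ ↦ (totalDegree_mul _ _).trans ?_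
    simp
  · by_contra hne
    refine hφ ⟨⟨⟨x, hx⟩, ⟨y, hy⟩⟩, by simpa using hne⟩ ?_
    have hev : ∀ z, eval z (∑ i, C (φ (Pi.single i 1)) * X i) = φ z := by
      intro z
      rw [LinearMap.pi_apply_eq_sum_univ φ z]
      simp only [map_sum, map_mul, eval_C, eval_X, smul_eq_mul]
      refine Finset.sum_congr rfl fun i _ ↦ ?_
      rw [mul_comm]
      congr 2
      ext j
      simp [Pi.single_apply, eq_comm]
    simp only [hev] at hxy
    simp [hxy]

/-- A Bezout inequality: a finite set cut out by equations of degree at most `s` in affine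
`n`-space has at most `s ^ n` points. -/
theorem ncard_le_pow_of_finite_zeros {k : Type*} [Field k] [IsAlgClosed k] (n s : ℕ) (hs : 2 ≤ s)
    (W : Submodule k (MvPolynomial (Fin n) k)) (hW : ∀ p ∈ W, p.totalDegree ≤ s)
    (Z : Set (Fin n → k)) (hZ : ∀ z, z ∈ Z ↔ ∀ p ∈ W, eval z p = 0) (hfin : Z.Finite) :
    Z.ncard ≤ s ^ n := by
  classical
  have : Infinite k := IsAlgClosed.instInfinite
  choose F hFW hF using exists_mem_forall_notMem_minimalPrimes (k := k) W
  let J : ℕ → Ideal (MvPolynomial (Fin n) k) := fun i ↦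
    Nat.rec ⊥ (fun _ I ↦ I ⊔ Ideal.span {F I}) i
  have hJs : ∀ i, J (i + 1) = J i ⊔ Ideal.span {F (J i)} := fun _ ↦ rfl
  have hmono : Monotone J := monotone_nat_of_le_succ fun i ↦ hJs i ▸ le_sup_left
  have hspan : ∀ i, J i = Ideal.span ((Finset.range i).image fun j ↦ F (J j) :
      Finset (MvPolynomial (Fin n) k)) := by
    intro i
    induction i with
    | zero => simp [J]
    | succ i ih =>
      rw [hJs, Finset.range_add_one, Finset.image_insert, Finset.coe_insert, Ideal.span_insert,
        ← ih, sup_comm]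
  obtain ⟨l, hl1, hlinj⟩ := exists_linear_injOn Z hfin
  obtain ⟨B, p, hB, hp0, hdeg, hrel⟩ := exists_algebraic_relation n s hs (fun i ↦ F (J i))
    (fun i ↦ hW _ (hFW _)) l hl1
  obtain ⟨β, hβ, H⟩ := exists_lowest_exponent (R := MvPolynomial (Fin n) k) n B hB
  have hroot : ∀ z ∈ Z, (p β).eval (eval z l) = 0 := by
    intro z hz
    have hWz : ∀ q ∈ W, q ∈ (vanishingIdeal k {z} : Ideal (MvPolynomial (Fin n) k)) := by
      intro q hq
      rw [mem_vanishingIdeal_singleton_iff, aeval_eq_eval_apply]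
      exact (hZ z).1 hz q hq
    have hJz : ∀ i, J i ≤ vanishingIdeal k {z} := by
      intro i
      rw [hspan, Ideal.span_le]
      intro q hq
      simp only [Finset.coe_image, Set.mem_image] at hq
      obtain ⟨j, -, rfl⟩ := hq
      exact hWz _ (hFW _)
    obtain ⟨P, hPn, hprime, hP⟩ := exists_chain_minimalPrimes J n (vanishingIdeal k {z})
      inferInstance (fun i _ ↦ hJz i) hmono
    have hstep : ∀ i < n, F (J i) ∈ P (i + 1) := by
      intro i hi
      rcases (Nat.succ_le_of_lt hi).lt_or_eq with h | h
      · refine (hP (i + 1) h).1.1.2 ?_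
        rw [hJs]
        exact Ideal.mem_sup_right (Ideal.mem_span_singleton_self _)
      · rw [Nat.succ_eq_add_one] at h
        rw [h, hPn]; exact hWz _ (hFW _)
    have hnot : ∀ i < n, ∃ w ∈ W, w ∉ P i := by
      intro i hi
      by_contra! hcon
      have hPz : P i ≤ vanishingIdeal k {z} := by
        suffices ∀ j, i ≤ j → j ≤ n → P i ≤ P j from hPn ▸ this n hi.le le_rfl
        intro j hij
        induction j, hij using Nat.le_induction with
        | base => exact fun _ ↦ le_rfl
        | succ j hij ih => exact fun h ↦ (ih (by omega)).trans (hP j (by omega)).2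
      have := hprime i hi.le
      have hle := vanishingIdeal_singleton_le_of_finite_zeroLocus (P i) z hPz
        (hfin.subset fun x hx ↦ (hZ x).2 fun q hq ↦ by
          have := hx q (hcon q hq)
          simpa [aeval_eq_eval_apply] using this)
      have h1 : (P i).height ≤ (i : ℕ∞) := by
        have h := (hP i hi).1
        rw [hspan] at h
        refine (Ideal.height_le_card_of_mem_minimalPrimes_span_finset h).trans ?_
        exact_mod_cast Finset.card_image_le.trans (by simp)
      have h2 := (le_height_vanishingIdeal_singleton n z).trans (Ideal.height_mono hle)
      have := h2.trans h1
      norm_cast at this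
      omega
    have key := H (fun b ↦ Polynomial.aeval l (p b)) (fun i ↦ F (J i)) P hprime
      (fun i hi ↦ (hP i hi).2) (fun i hi ↦ hF _ _ (hP i hi).1 (hnot i hi)) hstep
      (by rw [hrel]; exact Ideal.zero_mem _)
    rwa [hPn, mem_vanishingIdeal_singleton_iff, ← Polynomial.aeval_algHom_apply, aeval_eq_eval_apply,
      Polynomial.coe_aeval_eq_eval] at key
  calc Z.ncard ≤ ((p β).roots.toFinset : Set k).ncard := by
        refine Set.ncard_le_ncard_of_injOn (fun z ↦ eval z l) (fun z hz ↦ ?_) hlinj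
          (Finset.finite_toSet _)
        simpa [hp0 β hβ] using hroot z hz
    _ ≤ (p β).natDegree := by
        rw [Set.ncard_coe_finset]
        exact (Multiset.toFinset_card_le _).trans (Polynomial.card_roots' _)
    _ ≤ s ^ n := hdeg β

theorem derivation_aeval {k A : Type*} [CommRing k] [CommRing A] [Algebra k A] {n : ℕ}
    (D : Derivation k A A) (g : Fin n → A) (f : MvPolynomial (Fin n) k) :
    D (aeval g f) = ∑ i, aeval g (pderiv i f) * D (g i) := by
  induction f using MvPolynomial.induction_on with
  | C a => simp [algHom_C]
  | add p q hp hq => simp [hp, hq, add_mul, Finset.sum_add_distrib]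
  | mul_X p i hp =>
    simp only [map_mul, Derivation.leibniz, aeval_X, hp, smul_eq_mul, pderiv_X, map_add]
    rw [Finset.mul_sum]
    have : ∀ j, (aeval g p * aeval g (Pi.single (M := fun _ ↦ MvPolynomial (Fin n) k) j 1 i) +
        g i * aeval g (pderiv j p)) * D (g j) = (if j = i then aeval g p * D (g i) else 0) +
        g i * (aeval g (pderiv j p) * D (g j)) := by
      intro j
      by_cases h : j = i
      · subst h; simp; ring
      · simp [h, Ne.symm h]; ring
    simp only [this, Finset.sum_add_distrib]
    simp

/-- The restriction of `f` to the parametrised line `t ↦ t u + w`. -/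
noncomputable def restrictLine {k : Type*} [Field k] {n : ℕ} (u w : Fin n → k)
    (f : MvPolynomial (Fin n) k) : Polynomial k :=
  aeval (fun i ↦ Polynomial.C (u i) * Polynomial.X + Polynomial.C (w i)) f

theorem eval_restrictLine {k : Type*} [Field k] {n : ℕ} (u w : Fin n → k)
    (f : MvPolynomial (Fin n) k) (t : k) :
    (restrictLine u w f).eval t = eval (t • u + w) f := by
  have h : ((Polynomial.aeval t : Polynomial k →ₐ[k] k).comp
      (aeval fun i ↦ Polynomial.C (u i) * Polynomial.X + Polynomial.C (w i))) =
      aeval (t • u + w) := algHom_ext fun i ↦ by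
        simp only [AlgHom.comp_apply, aeval_X, Polynomial.coe_aeval_eq_eval, Polynomial.eval_add,
          Polynomial.eval_mul, Polynomial.eval_C, Polynomial.eval_X, Pi.add_apply, Pi.smul_apply,
          smul_eq_mul, mul_comm t]
  have h2 := DFunLike.congr_fun h f
  rw [AlgHom.comp_apply, Polynomial.coe_aeval_eq_eval] at h2
  rw [restrictLine, h2, ← coe_aeval_eq_eval]; rfl

theorem eval_derivative_restrictLine {k : Type*} [Field k] {n : ℕ} (u w : Fin n → k)
    (f : MvPolynomial (Fin n) k) :
    (Polynomial.derivative (restrictLine u w f)).eval 0 = ∑ i, u i * eval w (pderiv i f) := by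
  have h := derivation_aeval (Polynomial.derivative' (R := k))
    (fun i ↦ Polynomial.C (u i) * Polynomial.X + Polynomial.C (w i)) f
  rw [restrictLine]
  change Polynomial.eval 0 (Polynomial.derivative' _) = _
  rw [h, Polynomial.eval_finsetSum]
  refine Finset.sum_congr rfl fun i _ ↦ ?_
  have h3 := eval_restrictLine u w (pderiv i f) 0
  rw [restrictLine, zero_smul, zero_add] at h3
  rw [Polynomial.eval_mul, h3, mul_comm]
  congr 1
  simp [Polynomial.derivative']

/-- If `f` vanishes along an affine line, its directional derivative vanishes. -/
theorem sum_mul_pderiv_eq_zero {k : Type*} [Field k] [Infinite k] {n : ℕ} (u w : Fin n → k)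
    (f : MvPolynomial (Fin n) k) (h : ∀ t : k, eval (t • u + w) f = 0) :
    ∑ i, u i * eval w (pderiv i f) = 0 := by
  rw [← eval_derivative_restrictLine]
  have : restrictLine u w f = 0 := Polynomial.funext fun t ↦ by
    rw [eval_restrictLine, h, Polynomial.eval_zero]
  simp [this]

theorem natDegree_restrictLine_le {k : Type*} [Field k] {n : ℕ} (u w : Fin n → k)
    (f : MvPolynomial (Fin n) k) (m : ℕ) (hf : f.IsHomogeneous m) :
    (restrictLine u w f).natDegree ≤ m ∧ (restrictLine u w f).coeff m = eval u f := by
  have hprod : ∀ (S : Finset (Fin n)) (d : Fin n → ℕ), (∏ i ∈ S,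
      (Polynomial.C (u i) * Polynomial.X + Polynomial.C (w i)) ^ d i).natDegree ≤ ∑ i ∈ S, d i ∧
      (∏ i ∈ S, (Polynomial.C (u i) * Polynomial.X + Polynomial.C (w i)) ^ d i).coeff
        (∑ i ∈ S, d i) = ∏ i ∈ S, u i ^ d i := by
    intro S d
    induction S using Finset.induction_on with
    | empty => simp
    | insert i S hi ih =>
      have hlin : (Polynomial.C (u i) * Polynomial.X + Polynomial.C (w i)).natDegree ≤ 1 :=
        Polynomial.natDegree_linear_le
      have h1 : ((Polynomial.C (u i) * Polynomial.X + Polynomial.C (w i)) ^ d i).natDegree ≤ d i := by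
        simpa using Polynomial.natDegree_pow_le_of_le (d i) hlin
      have h2 := Polynomial.coeff_pow_of_natDegree_le (m := d i) hlin
      rw [mul_one] at h2
      rw [Finset.prod_insert hi, Finset.prod_insert hi, Finset.sum_insert hi]
      refine ⟨Polynomial.natDegree_mul_le_of_le h1 ih.1, ?_⟩
      rw [Polynomial.coeff_mul_add_eq_of_natDegree_le h1 ih.1, ih.2, h2]
      simp [Polynomial.coeff_C]
  have hdeg : ∀ d ∈ f.support, ∑ i, d i = m := fun d hd ↦ by
    have := hf (mem_support_iff.1 hd)
    rw [Finsupp.weight_apply, Finsupp.sum_fintype _ _ (by simp)] at this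
    simpa using this
  rw [restrictLine, aeval_def, eval₂_eq', eval_eq']
  constructor
  · refine Polynomial.natDegree_sum_le_of_forall_le _ _ fun d hd ↦ ?_
    have := (hprod Finset.univ d).1
    rw [hdeg d hd] at this
    exact (Polynomial.natDegree_C_mul_le _ _).trans this
  · rw [Polynomial.finsetSum_coeff]
    refine Finset.sum_congr rfl fun d hd ↦ ?_
    have := (hprod Finset.univ d).2
    rw [hdeg d hd] at this
    rw [← this]
    exact Polynomial.coeff_C_mul _

theorem restrictLine_ne_zero {k : Type*} [Field k] {n m : ℕ} (u w : Fin n → k)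
    (f : MvPolynomial (Fin n) k) (hf : f.IsHomogeneous m) (hu : eval u f ≠ 0) :
    restrictLine u w f ≠ 0 := fun h ↦ hu <| by
  rw [← (natDegree_restrictLine_le u w f m hf).2, h, Polynomial.coeff_zero]

theorem exists_eval_smul_add_eq_zero {k : Type*} [Field k] [IsAlgClosed k] {n m : ℕ}
    (hm : m ≠ 0) (u w : Fin n → k) (f : MvPolynomial (Fin n) k) (hf : f.IsHomogeneous m)
    (hu : eval u f ≠ 0) : ∃ t : k, eval (t • u + w) f = 0 := by
  obtain ⟨h1, h2⟩ := natDegree_restrictLine_le u w f m hf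
  have h3 : (restrictLine u w f).natDegree = m :=
    le_antisymm h1 (Polynomial.le_natDegree_of_ne_zero (h2 ▸ hu))
  have hd : (restrictLine u w f).degree ≠ 0 := by
    rw [Polynomial.degree_eq_natDegree (restrictLine_ne_zero u w f hf hu), h3]
    exact_mod_cast hm
  obtain ⟨t, ht⟩ := IsAlgClosed.exists_root _ hd
  exact ⟨t, by rw [← eval_restrictLine]; exact ht⟩

theorem exists_finset_eval_smul_add {k : Type*} [Field k] {n m : ℕ} (u w : Fin n → k)
    (f : MvPolynomial (Fin n) k) (hf : f.IsHomogeneous m) (hu : eval u f ≠ 0) :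
    ∃ A : Finset k, A.card ≤ m ∧ ∀ t, eval (t • u + w) f = 0 → t ∈ A := by
  classical
  refine ⟨(restrictLine u w f).roots.toFinset, (Multiset.toFinset_card_le _).trans
    ((Polynomial.card_roots' _).trans (natDegree_restrictLine_le u w f m hf).1), fun t ht ↦ ?_⟩
  rw [Multiset.mem_toFinset, Polynomial.mem_roots (restrictLine_ne_zero u w f hf hu),
    Polynomial.IsRoot, eval_restrictLine, ht]

/-- The polynomial `f ∘ e` for a linear map `e`. -/
noncomputable def compLinear {k : Type*} [Field k] {n : ℕ} (f : MvPolynomial (Fin n) k)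
    (e : (Fin n → k) →ₗ[k] (Fin n → k)) : MvPolynomial (Fin n) k :=
  aeval (fun i ↦ ∑ j, C (e (Pi.single j 1) i) * X j) f

theorem eval_aeval {k : Type*} [Field k] {m n : ℕ} (x : Fin n → k)
    (g : Fin m → MvPolynomial (Fin n) k) (f : MvPolynomial (Fin m) k) :
    eval x (aeval g f) = eval (fun i ↦ eval x (g i)) f := by
  rw [aeval_def, eval_eval₂, algebraMap_eq]
  simp only [eval]
  congr 1
  ext a
  simp

theorem eval_compLinear {k : Type*} [Field k] {n : ℕ} (f : MvPolynomial (Fin n) k)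
    (e : (Fin n → k) →ₗ[k] (Fin n → k)) (x : Fin n → k) :
    eval x (compLinear f e) = eval (e x) f := by
  rw [compLinear, eval_aeval]
  congr 2
  ext i
  conv_rhs => rw [LinearMap.pi_apply_eq_sum_univ e x, Finset.sum_apply]
  simp only [map_sum, map_mul, eval_C, eval_X, Pi.smul_apply, smul_eq_mul]
  refine Finset.sum_congr rfl fun j _ ↦ ?_
  have : (Pi.single j 1 : Fin n → k) = fun l ↦ if j = l then 1 else 0 := by
    ext l; simp [Pi.single_apply, eq_comm]
  rw [mul_comm, this]

theorem compLinear_isHomogeneous {k : Type*} [Field k] {n d : ℕ} (f : MvPolynomial (Fin n) k)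
    (hf : f.IsHomogeneous d) (e : (Fin n → k) →ₗ[k] (Fin n → k)) :
    (compLinear f e).IsHomogeneous d := by
  have := hf.aeval (fun i ↦ ∑ j, C (e (Pi.single j 1) i) * X j) (n := 1) fun i ↦
    IsHomogeneous.sum _ _ _ fun j _ ↦ by
      simpa using (isHomogeneous_C (Fin n) (e (Pi.single j 1) i)).mul (isHomogeneous_X k j)
  rwa [one_mul] at this

theorem sum_mul_pderiv_compLinear {k : Type*} [Field k] [Infinite k] {n : ℕ}
    (f : MvPolynomial (Fin n) k) (e : (Fin n → k) →ₗ[k] (Fin n → k)) (u v : Fin n → k) :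
    ∑ i, u i * eval v (pderiv i (compLinear f e)) = ∑ i, e u i * eval (e v) (pderiv i f) := by
  rw [← eval_derivative_restrictLine, ← eval_derivative_restrictLine]
  congr 2
  refine Polynomial.funext fun t ↦ ?_
  rw [eval_restrictLine, eval_restrictLine, eval_compLinear, map_add, map_smul]

theorem IsSmoothSurface.compLinear {k : Type*} [Field k] [Infinite k] {d : ℕ}
    {f : MvPolynomial (Fin 4) k} (hf : IsSmoothSurface f d)
    (e : (Fin 4 → k) ≃ₗ[k] (Fin 4 → k)) : IsSmoothSurface (compLinear f e) d := by
  refine ⟨fun h ↦ hf.1 (funext fun x ↦ ?_), compLinear_isHomogeneous f hf.2.1 _,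
    fun v hv hcon ↦ hf.2.2 (e v) (by simpa using hv) ⟨?_, fun i ↦ ?_⟩⟩
  · have := eval_compLinear f e (e.symm x)
    simpa [h] using this.symm
  · simpa [eval_compLinear] using hcon.1
  · have := sum_mul_pderiv_compLinear f e (e.symm (Pi.single i 1)) v
    simp only [hcon.2, mul_zero, Finset.sum_const_zero, LinearEquiv.coe_coe,
      LinearEquiv.apply_symm_apply] at this
    simpa [Pi.single_apply] using this.symm

theorem isLineOn_compLinear_comap {k : Type*} [Field k] {f : MvPolynomial (Fin 4) k}
    (e : (Fin 4 → k) ≃ₗ[k] (Fin 4 → k)) (N : Submodule k (Fin 4 → k)) :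
    IsLineOn (compLinear f e) (N.comap (e : (Fin 4 → k) →ₗ[k] (Fin 4 → k))) ↔ IsLineOn f N := by
  have h1 : Module.finrank k (N.comap (e : (Fin 4 → k) →ₗ[k] (Fin 4 → k))) =
      Module.finrank k N := by
    rw [Submodule.comap_equiv_eq_map_symm]
    exact LinearEquiv.finrank_map_eq e.symm N
  rw [IsLineOn, IsLineOn, h1]
  refine and_congr_right fun _ ↦ ⟨fun h v hv ↦ ?_, fun h v hv ↦ ?_⟩
  · have := h (e.symm v) (by simpa using hv)
    simpa [eval_compLinear] using this
  · simpa [eval_compLinear] using h (e v) (by simpa using hv)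

/-- Counting lines with a given property may be done after a linear change of coordinates. -/
theorem ncard_lines_le_of_compLinear {k : Type*} [Field k] {f : MvPolynomial (Fin 4) k}
    (e : (Fin 4 → k) ≃ₗ[k] (Fin 4 → k)) (P Q : Submodule k (Fin 4 → k) → Prop)
    (hPQ : ∀ N, P N → Q (N.comap (e : (Fin 4 → k) →ₗ[k] (Fin 4 → k)))) (m : ℕ)
    (hfin : {N | IsLineOn f N}.Finite)
    (h : {N | IsLineOn (compLinear f e) N}.Finite →
      {N | IsLineOn (compLinear f e) N ∧ Q N}.ncard ≤ m) :
    {N | IsLineOn f N ∧ P N}.ncard ≤ m := by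
  have hsurj : ∀ N : Submodule k (Fin 4 → k),
      (N.map (e : (Fin 4 → k) →ₗ[k] (Fin 4 → k))).comap (e : (Fin 4 → k) →ₗ[k] (Fin 4 → k)) = N :=
    fun N ↦ Submodule.comap_map_eq_of_injective e.injective N
  have hinj : Function.Injective
      fun N : Submodule k (Fin 4 → k) ↦ N.comap (e : (Fin 4 → k) →ₗ[k] (Fin 4 → k)) :=
    Submodule.comap_injective_of_surjective e.surjective
  have hfin' : {N | IsLineOn (compLinear f e) N}.Finite := by
    refine (hfin.image fun N ↦ N.comap (e : (Fin 4 → k) →ₗ[k] (Fin 4 → k))).subset fun N hN ↦ ?_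
    refine ⟨N.map (e : (Fin 4 → k) →ₗ[k] (Fin 4 → k)), ?_, hsurj N⟩
    rw [Set.mem_ofPred_eq, ← isLineOn_compLinear_comap e, hsurj]
    exact hN
  refine le_trans ?_ (h hfin')
  refine Set.ncard_le_ncard_of_injOn
    (fun N : Submodule k (Fin 4 → k) ↦ N.comap (e : (Fin 4 → k) →ₗ[k] (Fin 4 → k)))
    (fun N hN ↦ ⟨(isLineOn_compLinear_comap e N).2 hN.1, hPQ N hN.2⟩) hinj.injOn
    (hfin'.subset fun N hN ↦ hN.1)

theorem exists_basis_pair {k V : Type*} [Field k] [AddCommGroup V] [Module k V]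
    (L : Submodule k V) (h : Module.finrank k L = 2) :
    ∃ p q : V, p ∈ L ∧ q ∈ L ∧ (∀ x ∈ L, ∃ a b : k, x = a • p + b • q) ∧
      ∀ a b : k, a • p + b • q = 0 → a = 0 ∧ b = 0 := by
  have : Module.Finite k L := Module.finite_of_finrank_pos (by omega)
  let B := Module.finBasisOfFinrankEq k L h
  refine ⟨B 0, B 1, (B 0).2, (B 1).2, fun x hx ↦ ?_, fun a b hab ↦ ?_⟩
  · have := B.sum_repr ⟨x, hx⟩
    rw [Fin.sum_univ_two] at this
    exact ⟨_, _, (congrArg Subtype.val this).symm⟩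
  · have hab' : a • B 0 + b • B 1 = 0 := Subtype.ext (by simpa using hab)
    have h0 := Fintype.linearIndependent_iff.1 B.linearIndependent ![a, b]
      (by simpa [Fin.sum_univ_two] using hab')
    exact ⟨h0 0, h0 1⟩

/-- Coordinates adapted to two skew lines. -/
theorem exists_linearEquiv_of_skew {k : Type*} [Field k] (L₁ L₂ : Submodule k (Fin 4 → k))
    (h₁ : Module.finrank k L₁ = 2) (h₂ : Module.finrank k L₂ = 2) (h : L₁ ⊓ L₂ = ⊥) :
    ∃ e : (Fin 4 → k) ≃ₗ[k] (Fin 4 → k),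
      (∀ x, e x ∈ L₁ ↔ x 2 = 0 ∧ x 3 = 0) ∧ ∀ x, e x ∈ L₂ ↔ x 0 = 0 ∧ x 1 = 0 := by
  obtain ⟨p, q, hp, hq, -, hpq⟩ := exists_basis_pair L₁ h₁
  obtain ⟨p', q', hp', hq', -, hpq'⟩ := exists_basis_pair L₂ h₂
  let φ : (Fin 4 → k) →ₗ[k] (Fin 4 → k) :=
    (LinearMap.proj 0).smulRight p + (LinearMap.proj 1).smulRight q +
      (LinearMap.proj 2).smulRight p' + (LinearMap.proj 3).smulRight q'
  have hφ : ∀ x, φ x = x 0 • p + x 1 • q + (x 2 • p' + x 3 • q') := fun x ↦ by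
    simp [φ, add_assoc]
  have hm1 : ∀ a b : k, a • p + b • q ∈ L₁ := fun a b ↦
    L₁.add_mem (L₁.smul_mem _ hp) (L₁.smul_mem _ hq)
  have hm2 : ∀ a b : k, a • p' + b • q' ∈ L₂ := fun a b ↦
    L₂.add_mem (L₂.smul_mem _ hp') (L₂.smul_mem _ hq')
  have h0 : ∀ x, x ∈ L₁ → x ∈ L₂ → x = 0 := fun x h1 h2 ↦ by
    simpa [h] using (Submodule.mem_inf.2 ⟨h1, h2⟩ : x ∈ L₁ ⊓ L₂)
  have hL1 : ∀ x, φ x ∈ L₁ ↔ x 2 = 0 ∧ x 3 = 0 := fun x ↦ by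
    rw [hφ, L₁.add_mem_iff_right (hm1 _ _)]
    exact ⟨fun hx ↦ hpq' _ _ (h0 _ hx (hm2 _ _)), fun hx ↦ by simp [hx.1, hx.2]⟩
  have hL2 : ∀ x, φ x ∈ L₂ ↔ x 0 = 0 ∧ x 1 = 0 := fun x ↦ by
    rw [hφ, L₂.add_mem_iff_left (hm2 _ _)]
    exact ⟨fun hx ↦ hpq _ _ (h0 _ (hm1 _ _) hx), fun hx ↦ by simp [hx.1, hx.2]⟩
  have hinj : Function.Injective φ := by
    rw [injective_iff_map_eq_zero]
    intro x hx
    have h1 := (hL1 x).1 (hx ▸ L₁.zero_mem)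
    have h2 := (hL2 x).1 (hx ▸ L₂.zero_mem)
    ext i
    fin_cases i
    exacts [h2.1, h2.2, h1.1, h1.2]
  exact ⟨LinearEquiv.ofInjectiveEndo φ hinj, hL1, hL2⟩

theorem finrank_span_pair_eq_two {k V : Type*} [Field k] [AddCommGroup V] [Module k V] {p q : V}
    (h : ∀ a b : k, a • p + b • q = 0 → a = 0 ∧ b = 0) :
    Module.finrank k (Submodule.span k {p, q}) = 2 := by
  have := finrank_span_eq_card (LinearIndependent.pair_iff.2 h)
  rwa [Matrix.range_cons, Matrix.range_cons, Matrix.range_empty, Set.union_empty,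
    Set.singleton_union, Fintype.card_fin] at this

theorem eq_span_pair {k V : Type*} [Field k] [AddCommGroup V] [Module k V]
    [FiniteDimensional k V] {N : Submodule k V} (hN : Module.finrank k N = 2) {p q : V}
    (hp : p ∈ N) (hq : q ∈ N) (h : ∀ a b : k, a • p + b • q = 0 → a = 0 ∧ b = 0) :
    N = Submodule.span k {p, q} := by
  refine (Submodule.eq_of_le_of_finrank_eq (Submodule.span_le.2 ?_) ?_).symm
  · rintro x (rfl | rfl)
    exacts [hp, hq]
  · rw [finrank_span_pair_eq_two h, hN]

theorem exists_ne_zero_of_mem_support {k : Type*} [Field k] [Infinite k]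
    (f : MvPolynomial (Fin 4) k) (h : ∀ x : Fin 4 → k, x 0 = 0 → x 1 = 0 → eval x f = 0)
    (m : Fin 4 →₀ ℕ) (hm : m ∈ f.support) : 1 ≤ m 0 + m 1 := by
  let I : Ideal (MvPolynomial (Fin 4) k) := Ideal.span (X '' {0, 1})
  let g : Fin 4 → MvPolynomial (Fin 4) k := ![0, 0, X 2, X 3]
  have hg : aeval g f = 0 := by
    refine MvPolynomial.funext fun x ↦ ?_
    rw [eval_aeval, map_zero]
    exact h _ (by simp [g]) (by simp [g])
  have hX : ∀ i : Fin 4, i = 0 ∨ i = 1 → Ideal.Quotient.mk I (X i) = 0 := fun i hi ↦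
    Ideal.Quotient.eq_zero_iff_mem.2 (Ideal.subset_span ⟨i, by simpa using hi, rfl⟩)
  have hmk : (Ideal.Quotient.mkₐ k I).comp (aeval g) = Ideal.Quotient.mkₐ k I := by
    refine algHom_ext fun i ↦ ?_
    fin_cases i <;> simp [g, hX]
  have hfI : f ∈ I := by
    rw [← Ideal.Quotient.eq_zero_iff_mem]
    have := DFunLike.congr_fun hmk f
    rw [AlgHom.comp_apply, hg, map_zero] at this
    exact this.symm
  obtain ⟨i, hi, hmi⟩ := mem_ideal_span_X_image.1 hfI m hm
  rcases hi with rfl | rfl <;> omega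

theorem ncard_lines_skew_coordinate_line_le {k : Type*} [Field k] [IsAlgClosed k] {d : ℕ}
    (hd : 3 ≤ d) (f : MvPolynomial (Fin 4) k) (hf : f.IsHomogeneous d)
    (h : ∀ x : Fin 4 → k, x 0 = 0 → x 1 = 0 → eval x f = 0) (hfin : {N | IsLineOn f N}.Finite) :
    {N | IsLineOn f N ∧ ∀ x ∈ N, x 0 = 0 → x 1 = 0 → x = 0}.ncard ≤ (d - 1) ^ 4 := by
  have : Infinite k := IsAlgClosed.instInfinite
  let g : k × k → Fin 4 → MvPolynomial (Fin 4) k := fun τ ↦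
    ![C τ.1, C τ.2, C τ.1 * X 0 + C τ.2 * X 2, C τ.1 * X 1 + C τ.2 * X 3]
  let W : Submodule k (MvPolynomial (Fin 4) k) := Submodule.span k (Set.range fun τ ↦ aeval (g τ) f)
  let N : (Fin 4 → k) → Submodule k (Fin 4 → k) := fun z ↦
    Submodule.span k {![1, 0, z 0, z 1], ![0, 1, z 2, z 3]}
  have hcomb : ∀ (z : Fin 4 → k) (a b : k), a • ![1, 0, z 0, z 1] + b • ![0, 1, z 2, z 3] =
      ![a, b, a * z 0 + b * z 2, a * z 1 + b * z 3] := fun z a b ↦ by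
    ext i; fin_cases i <;> simp
  have hmemN : ∀ z x, x ∈ N z ↔ ∃ a b, ![a, b, a * z 0 + b * z 2, a * z 1 + b * z 3] = x := by
    intro z x
    simp only [N, Submodule.mem_span_pair, hcomb]
  have hind : ∀ (z : Fin 4 → k) (a b : k), a • ![1, 0, z 0, z 1] + b • ![0, 1, z 2, z 3] = 0 →
      a = 0 ∧ b = 0 := by
    intro z a b hab
    rw [hcomb] at hab
    exact ⟨by simpa using congrFun hab 0, by simpa using congrFun hab 1⟩
  have hlin : ∀ (i : Fin 4) (j : Fin 4) (a b : k),
      (C a * X i + C b * X j : MvPolynomial (Fin 4) k).totalDegree ≤ 1 := fun i j a b ↦ by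
    refine (totalDegree_add _ _).trans (max_le ?_ ?_) <;>
    exact (totalDegree_mul _ _).trans (by simp)
  have hWdeg : ∀ p ∈ W, p.totalDegree ≤ d - 1 := by
    suffices W ≤ restrictTotalDegree (Fin 4) k (d - 1) from
      fun p hp ↦ (mem_restrictTotalDegree _ _ _).1 (this hp)
    refine Submodule.span_le.2 ?_
    rintro _ ⟨τ, rfl⟩
    rw [SetLike.mem_coe, mem_restrictTotalDegree]
    dsimp only
    rw [aeval_def, eval₂_eq']
    refine totalDegree_finsetSum_le fun m hm ↦ ?_
    have h1 := exists_ne_zero_of_mem_support f h m hm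
    have h2 : m 0 + m 1 + m 2 + m 3 = d := by
      have := hf (mem_support_iff.1 hm)
      rw [Finsupp.weight_apply, Finsupp.sum_fintype _ _ (by simp), Fin.sum_univ_four] at this
      simpa using this
    have hpow : ∀ (p : MvPolynomial (Fin 4) k) (a c : ℕ), p.totalDegree ≤ c →
        (p ^ a).totalDegree ≤ a * c := fun p a c hp ↦
      (totalDegree_pow _ _).trans (Nat.mul_le_mul_left _ hp)
    rw [algebraMap_eq, Fin.prod_univ_four]
    simp only [g, Matrix.cons_val]
    have e0 := hpow (C τ.1 : MvPolynomial (Fin 4) k) (m 0) 0 (by simp)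
    have e1 := hpow (C τ.2 : MvPolynomial (Fin 4) k) (m 1) 0 (by simp)
    have e2 := hpow _ (m 2) 1 (hlin 0 2 τ.1 τ.2)
    have e3 := hpow _ (m 3) 1 (hlin 1 3 τ.1 τ.2)
    refine (totalDegree_mul _ _).trans ?_
    rw [totalDegree_C]
    have t1 := totalDegree_mul ((C τ.1 : MvPolynomial (Fin 4) k) ^ m 0 * C τ.2 ^ m 1 *
      (C τ.1 * X 0 + C τ.2 * X 2) ^ m 2) ((C τ.1 * X 1 + C τ.2 * X 3) ^ m 3)
    have t2 := totalDegree_mul ((C τ.1 : MvPolynomial (Fin 4) k) ^ m 0 * C τ.2 ^ m 1)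
      ((C τ.1 * X 0 + C τ.2 * X 2) ^ m 2)
    have t3 := totalDegree_mul ((C τ.1 : MvPolynomial (Fin 4) k) ^ m 0) (C τ.2 ^ m 1)
    omega
  let Z : Set (Fin 4 → k) := {z | IsLineOn f (N z)}
  have hZ : ∀ z, z ∈ Z ↔ ∀ p ∈ W, eval z p = 0 := by
    intro z
    have hev : ∀ τ : k × k, eval z (aeval (g τ) f) =
        eval ![τ.1, τ.2, τ.1 * z 0 + τ.2 * z 2, τ.1 * z 1 + τ.2 * z 3] f := by
      intro τ
      rw [eval_aeval]
      congr 2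
      ext i
      fin_cases i <;> simp [g]
    have hZ' : z ∈ Z ↔ ∀ τ : k × k, eval z (aeval (g τ) f) = 0 := by
      simp only [Z, Set.mem_ofPred_eq, IsLineOn, hev]
      constructor
      · exact fun hN τ ↦ hN.2 _ ((hmemN _ _).2 ⟨_, _, rfl⟩)
      · refine fun hτ ↦ ⟨finrank_span_pair_eq_two (hind z), fun v hv ↦ ?_⟩
        obtain ⟨a, b, rfl⟩ := (hmemN _ _).1 hv
        exact hτ (a, b)
    rw [hZ']
    constructor
    · intro hτ p hp
      have : W ≤ LinearMap.ker (aeval z : MvPolynomial (Fin 4) k →ₐ[k] k).toLinearMap := by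
        refine Submodule.span_le.2 ?_
        rintro _ ⟨τ, rfl⟩
        simpa [aeval_eq_eval_apply] using hτ τ
      simpa [aeval_eq_eval_apply] using this hp
    · exact fun hp τ ↦ hp _ (Submodule.subset_span ⟨τ, rfl⟩)
  have hNinj : Function.Injective N := by
    intro z z' hzz
    have h1 : ![1, 0, z 0, z 1] ∈ N z' := hzz ▸ (hmemN _ _).2 ⟨1, 0, by simp⟩
    have h2 : ![0, 1, z 2, z 3] ∈ N z' := hzz ▸ (hmemN _ _).2 ⟨0, 1, by simp⟩
    obtain ⟨a, b, hab⟩ := (hmemN _ _).1 h1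
    obtain ⟨a', b', hab'⟩ := (hmemN _ _).1 h2
    simp only [Matrix.vecCons_inj, and_true] at hab hab'
    obtain ⟨rfl, rfl, h3, h4⟩ := hab
    obtain ⟨rfl, rfl, h5, h6⟩ := hab'
    ext i
    fin_cases i
    · simpa using h3.symm
    · simpa using h4.symm
    · simpa using h5.symm
    · simpa using h6.symm
  have hZfin : Z.Finite := Set.Finite.of_injOn (f := N) (fun z hz ↦ hz) hNinj.injOn hfin
  have hsub : {M | IsLineOn f M ∧ ∀ x ∈ M, x 0 = 0 → x 1 = 0 → x = 0} ⊆ N '' Z := by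
    rintro M ⟨hM, hskew⟩
    let φ : M →ₗ[k] (Fin 2 → k) :=
      LinearMap.pi ![(LinearMap.proj 0).comp M.subtype, (LinearMap.proj 1).comp M.subtype]
    have hφinj : Function.Injective φ := by
      rw [injective_iff_map_eq_zero]
      intro x hx
      refine Subtype.ext (hskew x x.2 ?_ ?_)
      · simpa [φ] using congrFun hx 0
      · simpa [φ] using congrFun hx 1
    have hφ : Function.Surjective φ :=
      (LinearMap.injective_iff_surjective_of_finrank_eq_finrank (by simp [hM.1])).1 hφinj
    obtain ⟨p, hp⟩ := hφ ![1, 0]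
    obtain ⟨q, hq⟩ := hφ ![0, 1]
    let z : Fin 4 → k := ![p.1 2, p.1 3, q.1 2, q.1 3]
    have hpz : p.1 = ![1, 0, z 0, z 1] := by
      ext i; fin_cases i
      · simpa [φ] using congrFun hp 0
      · simpa [φ] using congrFun hp 1
      · rfl
      · rfl
    have hqz : q.1 = ![0, 1, z 2, z 3] := by
      ext i; fin_cases i
      · simpa [φ] using congrFun hq 0
      · simpa [φ] using congrFun hq 1
      · rfl
      · rfl
    have hMN : N z = M := (eq_span_pair hM.1 (hpz ▸ p.2) (hqz ▸ q.2) (hind z)).symm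
    exact ⟨z, show IsLineOn f (N z) from hMN ▸ hM, hMN⟩
  calc _ ≤ (N '' Z).ncard := Set.ncard_le_ncard hsub (hZfin.image _)
    _ ≤ Z.ncard := Set.ncard_image_le hZfin
    _ ≤ (d - 1) ^ 4 := ncard_le_pow_of_finite_zeros 4 (d - 1) (by omega) W hWdeg Z hZ hZfin

/-- At most `(d - 1) ^ 4` lines on a surface of degree `d` are skew to a given one. -/
theorem ncard_lines_skew_le {k : Type*} [Field k] [IsAlgClosed k] {d : ℕ}
    (hd : 3 ≤ d) (f : MvPolynomial (Fin 4) k) (hf : f.IsHomogeneous d)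
    (hfin : {N | IsLineOn f N}.Finite) (L : Submodule k (Fin 4 → k)) (hL : IsLineOn f L) :
    {N | IsLineOn f N ∧ N ⊓ L = ⊥}.ncard ≤ (d - 1) ^ 4 := by
  obtain ⟨L', hL'⟩ := Submodule.exists_isCompl L
  have hrank : Module.finrank k L' = 2 := by
    have := Submodule.finrank_add_eq_of_isCompl hL'
    rw [hL.1, Module.finrank_fin_fun] at this
    omega
  obtain ⟨e, -, he⟩ := exists_linearEquiv_of_skew L' L hrank hL.1 hL'.symm.inf_eq_bot
  refine ncard_lines_le_of_compLinear e (fun N ↦ N ⊓ L = ⊥)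
    (fun N ↦ ∀ x ∈ N, x 0 = 0 → x 1 = 0 → x = 0) (fun N hN x hx h0 h1 ↦ ?_) _ hfin fun hfin' ↦ ?_
  · have hmem : e x ∈ N ⊓ L := ⟨by simpa using hx, (he x).2 ⟨h0, h1⟩⟩
    rw [hN] at hmem
    simpa using hmem
  · refine ncard_lines_skew_coordinate_line_le hd _ (compLinear_isHomogeneous f hf _)
      (fun x h0 h1 ↦ ?_) hfin'
    rw [eval_compLinear]
    exact hL.2 _ ((he x).2 ⟨h0, h1⟩)

theorem eval_smul_of_isHomogeneous {k : Type*} [Field k] {n m : ℕ} {f : MvPolynomial (Fin n) k}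
    (hf : f.IsHomogeneous m) (c : k) (x : Fin n → k) : eval (c • x) f = c ^ m * eval x f := by
  rw [eval_eq', eval_eq', Finset.mul_sum]
  refine Finset.sum_congr rfl fun d hd ↦ ?_
  have : ∑ i, d i = m := by
    have := hf (mem_support_iff.1 hd)
    rw [Finsupp.weight_apply, Finsupp.sum_fintype _ _ (by simp)] at this
    simpa using this
  simp only [Pi.smul_apply, smul_eq_mul, mul_pow, Finset.prod_mul_distrib,
    Finset.prod_pow_eq_pow_sum, this]
  ring

theorem exists_eval_ne_zero_of_no_common_zero {k : Type*} [Field k] [IsAlgClosed k] {e : ℕ}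
    (he : 2 ≤ e) (U V : MvPolynomial (Fin 2) k) (hV : V.IsHomogeneous e)
    (h : ∀ a : Fin 2 → k, a ≠ 0 → ¬ (eval a U = 0 ∧ eval a V = 0)) :
    ∃ a : Fin 2 → k, eval a (X 0 * U + X 1 * V) ≠ 0 := by
  have : Infinite k := IsAlgClosed.instInfinite
  by_contra! hG
  have hG' : ∀ a : Fin 2 → k, a 0 * eval a U + a 1 * eval a V = 0 := fun a ↦ by simpa using hG a
  have hconst : ∀ P : Polynomial k, (∀ t, P.eval t ≠ 0) → ∃ c, c ≠ 0 ∧ ∀ t, P.eval t = c := by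
    intro P hP
    have hdeg : P.degree = 0 := by
      by_contra hdeg
      obtain ⟨t, ht⟩ := IsAlgClosed.exists_root P hdeg
      exact hP t ht
    have hC := Polynomial.eq_C_of_degree_eq_zero hdeg
    refine ⟨P.coeff 0, fun h0 ↦ hP 0 ?_, fun t ↦ ?_⟩ <;> rw [hC]
    · rw [h0]; simp
    · simp
  obtain ⟨v, hv, hv'⟩ := hconst (restrictLine ![0, 1] ![1, 0] V) fun t ht ↦ by
    rw [eval_restrictLine] at ht
    have := hG' (t • ![0, 1] + ![1, 0])
    refine h (t • ![0, 1] + ![1, 0]) (fun h0 ↦ by simpa using congrFun h0 0) ⟨?_, ht⟩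
    rw [ht, mul_zero, add_zero] at this
    exact (mul_eq_zero.1 this).resolve_left (by simp)
  obtain ⟨u, -, hu'⟩ := hconst (restrictLine ![1, 0] ![0, 1] U) fun t ht ↦ by
    rw [eval_restrictLine] at ht
    have := hG' (t • ![1, 0] + ![0, 1])
    refine h (t • ![1, 0] + ![0, 1]) (fun h0 ↦ by simpa using congrFun h0 1) ⟨ht, ?_⟩
    rw [ht, mul_zero, zero_add] at this
    exact (mul_eq_zero.1 this).resolve_left (by simp)
  have hpoly : (Polynomial.C v * Polynomial.X ^ e + Polynomial.C u * Polynomial.X : Polynomial k)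
      = 0 := by
    refine Polynomial.funext fun t ↦ ?_
    by_cases ht : t = 0
    · simp [ht, show e ≠ 0 by omega]
    · have h1 : (t • ![1, 0] + ![0, 1] : Fin 2 → k) = t • (t⁻¹ • ![0, 1] + ![1, 0]) := by
        ext i; fin_cases i <;> simp [ht]
      have h2 := hG' (t • ![1, 0] + ![0, 1])
      have h3 := hu' t
      rw [eval_restrictLine] at h3
      have h4 := hv' t⁻¹
      rw [eval_restrictLine] at h4
      have h5 := eval_smul_of_isHomogeneous hV t (t⁻¹ • ![0, 1] + ![1, 0])
      rw [← h1, h4] at h5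
      rw [h3, h5] at h2
      simp at h2 ⊢
      linear_combination h2
  have := congrArg (Polynomial.coeff · e) hpoly
  simp [Polynomial.coeff_X, show 1 ≠ e by omega, hv] at this

theorem exists_smul_eq_of_mul_add_mul_eq_zero {k : Type*} [Field k] {A B b₀ b₁ : k}
    (h : b₀ * A + b₁ * B = 0) (hAB : ¬ (A = 0 ∧ B = 0)) (hb : ¬ (b₀ = 0 ∧ b₁ = 0)) :
    ∃ c : k, c ≠ 0 ∧ b₀ = c * B ∧ b₁ = c * -A := by
  by_cases hB : B = 0
  · have hA : A ≠ 0 := fun hA ↦ hAB ⟨hA, hB⟩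
    have hb0 : b₀ = 0 := by simpa [hB, hA] using h
    exact ⟨-b₁ / A, div_ne_zero (neg_ne_zero.2 fun h1 ↦ hb ⟨hb0, h1⟩) hA, by simp [hb0, hB],
      by field_simp⟩
  · have hb0 : b₀ ≠ 0 := fun hb0 ↦ hb ⟨hb0, by simpa [hb0, hB] using h⟩
    refine ⟨b₀ / B, div_ne_zero hb0 hB, by field_simp, ?_⟩
    field_simp
    linear_combination h

set_option maxHeartbeats 400000 in
theorem ncard_transversals_coordinate_lines_le {k : Type*} [Field k] [IsAlgClosed k] {d : ℕ}
    (hd : 3 ≤ d) (f : MvPolynomial (Fin 4) k) (hf : IsSmoothSurface f d)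
    (h₁ : ∀ x : Fin 4 → k, x 2 = 0 → x 3 = 0 → eval x f = 0)
    (h₂ : ∀ x : Fin 4 → k, x 0 = 0 → x 1 = 0 → eval x f = 0) :
    {N | IsLineOn f N ∧ (∃ x ∈ N, x ≠ 0 ∧ x 2 = 0 ∧ x 3 = 0) ∧
      ∃ x ∈ N, x ≠ 0 ∧ x 0 = 0 ∧ x 1 = 0}.ncard ≤ (d - 1) ^ 2 + 1 := by
  classical
  have : Infinite k := IsAlgClosed.instInfinite
  let ι₁ : Fin 4 → MvPolynomial (Fin 2) k := ![X 0, X 1, 0, 0]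
  let ι₂ : Fin 4 → MvPolynomial (Fin 2) k := ![0, 0, X 0, X 1]
  have hι₁ : ∀ i, (ι₁ i).IsHomogeneous 1 := fun i ↦ by
    fin_cases i
    exacts [isHomogeneous_X _ _, isHomogeneous_X _ _, isHomogeneous_zero _ _ _,
      isHomogeneous_zero _ _ _]
  have hι₂ : ∀ i, (ι₂ i).IsHomogeneous 1 := fun i ↦ by
    fin_cases i
    exacts [isHomogeneous_zero _ _ _, isHomogeneous_zero _ _ _, isHomogeneous_X _ _,
      isHomogeneous_X _ _]
  have heval₁ : ∀ (a : Fin 2 → k) p, eval a (aeval ι₁ p) = eval ![a 0, a 1, 0, 0] p := by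
    intro a p
    rw [eval_aeval]; congr 2; ext i; fin_cases i <;> simp [ι₁]
  have heval₂ : ∀ (a : Fin 2 → k) p, eval a (aeval ι₂ p) = eval ![0, 0, a 0, a 1] p := by
    intro a p
    rw [eval_aeval]; congr 2; ext i; fin_cases i <;> simp [ι₂]
  have hhom₁ : ∀ i, (aeval ι₁ (pderiv i f)).IsHomogeneous (d - 1) := fun i ↦ by
    simpa only [one_mul] using (hf.2.1.pderiv (i := i)).aeval ι₁ hι₁
  have hhom₂ : ∀ i, (aeval ι₂ (pderiv i f)).IsHomogeneous (d - 1) := fun i ↦ by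
    simpa only [one_mul] using (hf.2.1.pderiv (i := i)).aeval ι₂ hι₂
  have hpd : ∀ (i : Fin 4) (x : Fin 4 → k), (∀ t : k, eval (t • Pi.single i 1 + x) f = 0) →
      eval x (pderiv i f) = 0 := fun i x hx ↦ by
    simpa [Pi.single_apply] using sum_mul_pderiv_eq_zero _ _ f hx
  have hns₁ : ∀ a : Fin 2 → k, a ≠ 0 →
      ¬ (eval a (aeval ι₁ (pderiv 2 f)) = 0 ∧ eval a (aeval ι₁ (pderiv 3 f)) = 0) := by
    rintro a ha ⟨e2, e3⟩
    rw [heval₁] at e2 e3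
    refine hf.2.2 ![a 0, a 1, 0, 0] (fun h0 ↦ ha ?_) ⟨h₁ _ (by simp) (by simp), fun i ↦ ?_⟩
    · ext i; fin_cases i
      · simpa using congrFun h0 0
      · simpa using congrFun h0 1
    · fin_cases i
      · exact hpd _ _ fun t ↦ h₁ _ (by simp) (by simp)
      · exact hpd _ _ fun t ↦ h₁ _ (by simp) (by simp)
      · exact e2
      · exact e3
  have hns₂ : ∀ b : Fin 2 → k, b ≠ 0 →
      ¬ (eval b (aeval ι₂ (pderiv 0 f)) = 0 ∧ eval b (aeval ι₂ (pderiv 1 f)) = 0) := by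
    rintro b hb ⟨e0, e1⟩
    rw [heval₂] at e0 e1
    refine hf.2.2 ![0, 0, b 0, b 1] (fun h0 ↦ hb ?_) ⟨h₂ _ (by simp) (by simp), fun i ↦ ?_⟩
    · ext i; fin_cases i
      · simpa using congrFun h0 2
      · simpa using congrFun h0 3
    · fin_cases i
      · exact e0
      · exact e1
      · exact hpd _ _ fun t ↦ h₂ _ (by simp) (by simp)
      · exact hpd _ _ fun t ↦ h₂ _ (by simp) (by simp)
  obtain ⟨β, hβ₀, hβ₁⟩ : ∃ β : Fin 2 → MvPolynomial (Fin 2) k,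
      β 0 = aeval ι₁ (pderiv 3 f) ∧ β 1 = -aeval ι₁ (pderiv 2 f) := ⟨![_, _], rfl, rfl⟩
  have hβ : ∀ i, (β i).IsHomogeneous (d - 1) := fun i ↦ by
    fin_cases i
    · exact hβ₀ ▸ hhom₁ 3
    · exact hβ₁ ▸ (hhom₁ 2).neg
  obtain ⟨U, hUdef⟩ : ∃ U, U = aeval β (aeval ι₂ (pderiv 0 f)) := ⟨_, rfl⟩
  obtain ⟨V, hVdef⟩ : ∃ V, V = aeval β (aeval ι₂ (pderiv 1 f)) := ⟨_, rfl⟩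
  have hU : U.IsHomogeneous ((d - 1) * (d - 1)) := hUdef ▸ (hhom₂ 0).aeval β hβ
  have hV : V.IsHomogeneous ((d - 1) * (d - 1)) := hVdef ▸ (hhom₂ 1).aeval β hβ
  have hβ0 : ∀ a : Fin 2 → k, a ≠ 0 → (fun i ↦ eval a (β i)) ≠ 0 := by
    intro a ha h0
    exact hns₁ a ha ⟨by simpa [hβ₁] using congrFun h0 1, by simpa [hβ₀] using congrFun h0 0⟩
  obtain ⟨u, hu⟩ := exists_eval_ne_zero_of_no_common_zero (by nlinarith [show 2 ≤ d - 1 by omega])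
    U V hV fun a ha h0 ↦ hns₂ _ (hβ0 a ha) (by
      rwa [hUdef, hVdef, eval_aeval a β, eval_aeval a β] at h0)
  obtain ⟨G, hGdef⟩ : ∃ G, G = X 0 * U + X 1 * V := ⟨_, rfl⟩
  rw [← hGdef] at hu
  have hG : G.IsHomogeneous ((d - 1) ^ 2 + 1) := by
    rw [hGdef, pow_two, add_comm ((d - 1) * (d - 1))]
    exact ((isHomogeneous_X k (0 : Fin 2)).mul hU).add ((isHomogeneous_X k (1 : Fin 2)).mul hV)
  let line : (Fin 2 → k) → Submodule k (Fin 4 → k) := fun a ↦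
    Submodule.span k {![a 0, a 1, 0, 0], ![0, 0, eval a (β 0), eval a (β 1)]}
  have key : ∀ N, IsLineOn f N → (∃ x ∈ N, x ≠ 0 ∧ x 0 = 0 ∧ x 1 = 0) → ∀ a : Fin 2 → k, a ≠ 0 →
      ![a 0, a 1, 0, 0] ∈ N → eval a G = 0 ∧ N = line a := by
    rintro N hN ⟨y, hyN, hy0, hy⟩ a ha haN
    have hyb : y = ![0, 0, y 2, y 3] := by
      ext i; fin_cases i
      exacts [hy.1, hy.2, rfl, rfl]
    have hT₁ := sum_mul_pderiv_eq_zero y ![a 0, a 1, 0, 0] f fun t ↦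
      hN.2 _ (N.add_mem (N.smul_mem _ hyN) haN)
    have hT₂ := sum_mul_pderiv_eq_zero ![a 0, a 1, 0, 0] y f fun t ↦
      hN.2 _ (N.add_mem (N.smul_mem _ haN) hyN)
    simp only [Fin.sum_univ_four, hy.1, hy.2, zero_mul, zero_add, Matrix.cons_val, add_zero,
      ← heval₁] at hT₁ hT₂
    obtain ⟨c, hc, hc2, hc3⟩ := exists_smul_eq_of_mul_add_mul_eq_zero hT₁ (hns₁ a ha)
      fun h0 ↦ hy0 (by rw [hyb, h0.1, h0.2]; ext i; fin_cases i <;> rfl)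
    have hyc : y = ![0, 0, (c • fun i ↦ eval a (β i)) 0, (c • fun i ↦ eval a (β i)) 1] := by
      rw [hyb, hc2, hc3]; simp [hβ₀, hβ₁]
    rw [hyc, ← heval₂, ← heval₂, eval_smul_of_isHomogeneous (hhom₂ 0),
      eval_smul_of_isHomogeneous (hhom₂ 1), ← eval_aeval, ← eval_aeval, ← hUdef, ← hVdef] at hT₂
    constructor
    · have : c ^ (d - 1) * eval a G = 0 := by
        simp only [hGdef, map_add, map_mul, eval_X]
        linear_combination hT₂
      exact (mul_eq_zero.1 this).resolve_left (pow_ne_zero _ hc)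
    · have hmem : ![0, 0, eval a (β 0), eval a (β 1)] ∈ N := by
        have : ![0, 0, eval a (β 0), eval a (β 1)] = c⁻¹ • y := by
          rw [hyc]; ext i; fin_cases i <;> simp [hc]
        rw [this]
        exact N.smul_mem _ hyN
      refine eq_span_pair hN.1 haN hmem fun r t hrt ↦ ⟨?_, ?_⟩
      · by_contra hr
        refine ha ?_
        ext i; fin_cases i
        · simpa [hr] using congrFun hrt 0
        · simpa [hr] using congrFun hrt 1
      · by_contra ht
        refine hβ0 a ha ?_
        ext i; fin_cases i
        · simpa [ht] using congrFun hrt 2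
        · simpa [ht] using congrFun hrt 3
  obtain ⟨w, hw⟩ : ∃ w : Fin 2 → k, u 0 * w 1 - u 1 * w 0 ≠ 0 := by
    by_cases h0 : u 0 = 0
    · refine ⟨![1, 0], fun h1 ↦ hu ?_⟩
      have h1' : u 1 = 0 := by simpa using h1
      simp [hGdef, h0, h1']
    · exact ⟨![0, 1], by simpa using h0⟩
  obtain ⟨A, hA, hAroot⟩ := exists_finset_eval_smul_add u w G hG hu
  refine le_trans ?_ hA
  refine le_trans (Set.ncard_le_ncard (t := (A.image fun t ↦ line (t • u + w) :
    Finset (Submodule k (Fin 4 → k)))) ?_ (Finset.finite_toSet _)) ?_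
  · rintro N ⟨hN, ⟨x, hxN, hx0, hx2, hx3⟩, hy⟩
    have hxa : x = ![x 0, x 1, 0, 0] := by
      ext i; fin_cases i
      exacts [rfl, rfl, hx2, hx3]
    have ha : (![x 0, x 1] : Fin 2 → k) ≠ 0 := fun h0 ↦ hx0 <| by
      rw [hxa]
      ext i; fin_cases i
      · simpa using congrFun h0 0
      · simpa using congrFun h0 1
      · rfl
      · rfl
    have hGx := (key N hN hy ![x 0, x 1] ha (by simpa using hxa ▸ hxN)).1
    set δ := u 0 * w 1 - u 1 * w 0 with hδ
    set α := (x 0 * w 1 - x 1 * w 0) / δ with hα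
    set γ := (u 0 * x 1 - u 1 * x 0) / δ with hγ
    have hdecomp : (![x 0, x 1] : Fin 2 → k) = α • u + γ • w := by
      ext i; fin_cases i
      · simp [hα, hγ]; field_simp; rw [hδ]; ring
      · simp [hα, hγ]; field_simp; rw [hδ]; ring
    have hγ0 : γ ≠ 0 := by
      intro h0
      rw [hdecomp, h0, zero_smul, add_zero, eval_smul_of_isHomogeneous hG] at hGx
      have hα0 : α = 0 := by
        rcases mul_eq_zero.1 hGx with h | h
        · exact pow_eq_zero_iff (by omega) |>.1 h
        · exact absurd h hu
      exact ha (by rw [hdecomp, h0, hα0]; simp)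
    have hscale : (α / γ) • u + w = γ⁻¹ • ![x 0, x 1] := by
      rw [hdecomp, smul_add, smul_smul, smul_smul, inv_mul_cancel₀ hγ0, one_smul, div_eq_inv_mul]
    have hmem : ![((α / γ) • u + w) 0, ((α / γ) • u + w) 1, 0, 0] ∈ N := by
      have : ![((α / γ) • u + w) 0, ((α / γ) • u + w) 1, 0, 0] = γ⁻¹ • x := by
        rw [hscale]
        ext i; fin_cases i <;> simp [hx2, hx3]
      rw [this]
      exact N.smul_mem _ hxN
    have hne : (α / γ) • u + w ≠ 0 := by
      rw [hscale]; exact smul_ne_zero (inv_ne_zero hγ0) ha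
    obtain ⟨hroot, hline⟩ := key N hN hy _ hne hmem
    rw [Finset.coe_image]
    exact ⟨_, hAroot _ hroot, hline.symm⟩
  · rw [Set.ncard_coe_finset]
    exact Finset.card_image_le

/-- Two skew lines on a smooth surface of degree `d` have at most `(d - 1) ^ 2 + 1` common
transversals on the surface. -/
theorem ncard_transversals_le {k : Type*} [Field k] [IsAlgClosed k] {d : ℕ}
    (hd : 3 ≤ d) (f : MvPolynomial (Fin 4) k) (hf : IsSmoothSurface f d)
    (hfin : {N | IsLineOn f N}.Finite) (L₁ L₂ : Submodule k (Fin 4 → k)) (h₁ : IsLineOn f L₁)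
    (h₂ : IsLineOn f L₂) (h : L₁ ⊓ L₂ = ⊥) :
    {N | IsLineOn f N ∧ N ⊓ L₁ ≠ ⊥ ∧ N ⊓ L₂ ≠ ⊥}.ncard ≤ (d - 1) ^ 2 + 1 := by
  have : Infinite k := IsAlgClosed.instInfinite
  obtain ⟨e, he₁, he₂⟩ := exists_linearEquiv_of_skew L₁ L₂ h₁.1 h₂.1 h
  have hmeet : ∀ (L : Submodule k (Fin 4 → k)) (Q : (Fin 4 → k) → Prop),
      (∀ x, e x ∈ L ↔ Q x) → ∀ N : Submodule k (Fin 4 → k), N ⊓ L ≠ ⊥ →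
      ∃ x ∈ N.comap (e : (Fin 4 → k) →ₗ[k] (Fin 4 → k)), x ≠ 0 ∧ Q x := by
    intro L Q hQ N hN
    obtain ⟨y, hy, hy0⟩ := Submodule.exists_mem_ne_zero_of_ne_bot hN
    exact ⟨e.symm y, by simpa using hy.1, by simpa using hy0, (hQ _).1 (by simpa using hy.2)⟩
  refine ncard_lines_le_of_compLinear e (fun N ↦ N ⊓ L₁ ≠ ⊥ ∧ N ⊓ L₂ ≠ ⊥)
    (fun N ↦ (∃ x ∈ N, x ≠ 0 ∧ x 2 = 0 ∧ x 3 = 0) ∧ ∃ x ∈ N, x ≠ 0 ∧ x 0 = 0 ∧ x 1 = 0)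
    (fun N hN ↦ ⟨hmeet L₁ (fun x ↦ x 2 = 0 ∧ x 3 = 0) he₁ N hN.1,
      hmeet L₂ (fun x ↦ x 0 = 0 ∧ x 1 = 0) he₂ N hN.2⟩) _ hfin fun _ ↦ ?_
  refine ncard_transversals_coordinate_lines_le hd _ (hf.compLinear e)
      (fun x h0 h1 ↦ ?_) (fun x h0 h1 ↦ ?_)
  · rw [eval_compLinear]
    exact h₁.2 _ ((he₁ x).2 ⟨h0, h1⟩)
  · rw [eval_compLinear]
    exact h₂.2 _ ((he₂ x).2 ⟨h0, h1⟩)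

theorem finrank_inf_eq_one {k V : Type*} [Field k] [AddCommGroup V] [Module k V]
    [FiniteDimensional k V] {L N : Submodule k V} (hL : Module.finrank k L = 2)
    (hN : Module.finrank k N = 2) (hne : L ≠ N) (hmeet : L ⊓ N ≠ ⊥) :
    Module.finrank k (L ⊓ N : Submodule k V) = 1 := by
  have h1 : Module.finrank k (L ⊓ N : Submodule k V) ≠ 0 := fun h ↦
    hmeet (Submodule.finrank_eq_zero.1 h)
  have h2 : Module.finrank k (L ⊓ N : Submodule k V) ≠ 2 := fun h ↦ hne <|
    (Submodule.eq_of_le_of_finrank_eq inf_le_left (h.trans hL.symm)).symm.trans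
      (Submodule.eq_of_le_of_finrank_eq inf_le_right (h.trans hN.symm))
  have h3 := Submodule.finrank_mono (inf_le_left : L ⊓ N ≤ L)
  omega

theorem finrank_sup_eq_three {k V : Type*} [Field k] [AddCommGroup V] [Module k V]
    [FiniteDimensional k V] {L N : Submodule k V} (hL : Module.finrank k L = 2)
    (hN : Module.finrank k N = 2) (hne : L ≠ N) (hmeet : L ⊓ N ≠ ⊥) :
    Module.finrank k (L ⊔ N : Submodule k V) = 3 := by
  have h1 := finrank_inf_eq_one hL hN hne hmeet
  have h2 := Submodule.finrank_sup_add_finrank_inf_eq L N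
  omega

/-- The hyperplane orthogonal to the gradient of `f` at `v`. -/
noncomputable def tangentSpace {k : Type*} [Field k] {n : ℕ} (f : MvPolynomial (Fin n) k)
    (v : Fin n → k) : Submodule k (Fin n → k) :=
  LinearMap.ker (∑ i, eval v (pderiv i f) • (LinearMap.proj i : (Fin n → k) →ₗ[k] k))

theorem mem_tangentSpace {k : Type*} [Field k] {n : ℕ} {f : MvPolynomial (Fin n) k}
    {v x : Fin n → k} : x ∈ tangentSpace f v ↔ ∑ i, x i * eval v (pderiv i f) = 0 := by
  simp [tangentSpace, mul_comm]

theorem IsSmoothSurface.finrank_tangentSpace_le {k : Type*} [Field k] {d : ℕ}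
    {f : MvPolynomial (Fin 4) k} (hf : IsSmoothSurface f d) {v : Fin 4 → k} (hv : v ≠ 0)
    (hv' : eval v f = 0) : Module.finrank k (tangentSpace f v) ≤ 3 := by
  by_contra! h
  have htop : tangentSpace f v = ⊤ := Submodule.eq_top_of_finrank_eq <| le_antisymm
    (Submodule.finrank_le _) (by rw [Module.finrank_fin_fun]; exact h)
  refine hf.2.2 v hv ⟨hv', fun i ↦ ?_⟩
  have := mem_tangentSpace.1 (htop ▸ Submodule.mem_top : Pi.single i 1 ∈ tangentSpace f v)
  simpa [Pi.single_apply] using this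

theorem IsLineOn.le_tangentSpace {k : Type*} [Field k] [Infinite k]
    {f : MvPolynomial (Fin 4) k} {N : Submodule k (Fin 4 → k)} (hN : IsLineOn f N)
    {v : Fin 4 → k} (hv : v ∈ N) : N ≤ tangentSpace f v := fun _ hu ↦
  mem_tangentSpace.2 <| sum_mul_pderiv_eq_zero _ _ f fun _ ↦
    hN.2 _ (N.add_mem (N.smul_mem _ hu) hv)

/-- A smooth surface contains no plane. -/
theorem IsSmoothSurface.exists_eval_ne_zero {k : Type*} [Field k] [IsAlgClosed k] {d : ℕ}
    (hd : 2 ≤ d) {f : MvPolynomial (Fin 4) k} (hf : IsSmoothSurface f d)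
    (H : Submodule k (Fin 4 → k)) (hH : Module.finrank k H = 3) : ∃ x ∈ H, eval x f ≠ 0 := by
  have : Infinite k := IsAlgClosed.instInfinite
  by_contra! h
  obtain ⟨y, hy⟩ : ∃ y, y ∉ H := by
    by_contra! hy
    have : H = ⊤ := (Submodule.eq_top_iff').2 hy
    rw [this] at hH
    simp at hH
  have hle : ∀ v ∈ H, H ≤ tangentSpace f v := fun v hv u hu ↦ mem_tangentSpace.2 <|
    sum_mul_pderiv_eq_zero _ _ f fun t ↦ h _ (H.add_mem (H.smul_mem t hu) hv)
  have hy' : ∀ v ∈ H, v ≠ 0 → y ∉ tangentSpace f v := by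
    intro v hv hv0 hmem
    have h1 : H < tangentSpace f v := lt_of_le_of_ne (hle v hv) fun heq ↦ hy (heq ▸ hmem)
    have h2 := Submodule.finrank_lt_finrank_of_lt h1
    have h3 := hf.finrank_tangentSpace_le hv0 (h v hv)
    omega
  obtain ⟨g, hg⟩ : ∃ g : MvPolynomial (Fin 4) k, g = ∑ i, C (y i) * pderiv i f := ⟨_, rfl⟩
  have hghom : g.IsHomogeneous (d - 1) := hg ▸ IsHomogeneous.sum _ _ _ fun i _ ↦ by
    simpa using (isHomogeneous_C _ (y i)).mul (hf.2.1.pderiv (i := i))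
  have hgeval : ∀ v, eval v g = ∑ i, y i * eval v (pderiv i f) := fun v ↦ by simp [hg]
  obtain ⟨p, q, hp, hq, hpq⟩ : ∃ p q, p ∈ H ∧ q ∈ H ∧
      ∀ a b : k, a • p + b • q = 0 → a = 0 ∧ b = 0 := by
    have : Nontrivial H := Module.nontrivial_of_finrank_pos (R := k) (by omega)
    obtain ⟨p, hp⟩ := exists_ne (0 : H)
    obtain ⟨q, hq⟩ := exists_linearIndependent_pair_of_one_lt_finrank (R := k) (by omega) hp
    refine ⟨p, q, p.2, q.2, fun a b hab ↦ LinearIndependent.pair_iff.1 hq a b (Subtype.ext ?_)⟩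
    simpa using hab
  have hp0 : p ≠ 0 := fun h0 ↦ one_ne_zero (hpq 1 0 (by simp [h0])).1
  obtain ⟨t, ht⟩ := exists_eval_smul_add_eq_zero (m := d - 1) (by omega) p q g hghom fun h0 ↦
    hy' p hp hp0 (mem_tangentSpace.2 (by rw [← hgeval, h0]))
  refine hy' _ (H.add_mem (H.smul_mem t hp) hq) (fun h0 ↦ ?_)
    (mem_tangentSpace.2 (by rw [← hgeval, ht]))
  exact one_ne_zero (hpq t 1 (by simpa using h0)).2

/-- A plane contains at most `d` lines of a smooth surface of degree `d`. -/
theorem ncard_lines_le_plane {k : Type*} [Field k] [IsAlgClosed k] {d : ℕ}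
    (hd : 2 ≤ d) {f : MvPolynomial (Fin 4) k} (hf : IsSmoothSurface f d)
    (hfin : {N | IsLineOn f N}.Finite)
    (H : Submodule k (Fin 4 → k)) (hH : Module.finrank k H = 3) :
    {N | IsLineOn f N ∧ N ≤ H}.ncard ≤ d := by
  have : Infinite k := IsAlgClosed.instInfinite
  obtain ⟨x, hxH, hx⟩ := hf.exists_eval_ne_zero hd H hH
  have hfin' : {N | IsLineOn f N ∧ N ≤ H}.Finite := hfin.subset fun N hN ↦ hN.1
  obtain ⟨w, hwH, hw⟩ : ∃ w ∈ H, ∀ N N', (IsLineOn f N ∧ N ≤ H) → (IsLineOn f N' ∧ N' ≤ H) →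
      N ≠ N' → w ∉ (N ⊓ N') ⊔ Submodule.span k {x} := by
    have := hfin'.to_subtype
    let ι := {p : {N | IsLineOn f N ∧ N ≤ H} × {N | IsLineOn f N ∧ N ≤ H} // p.1.1 ≠ p.2.1}
    obtain ⟨w, hw⟩ := Submodule.exists_forall_notMem_of_forall_ne_top
      (fun p : ι ↦ ((p.1.1.1 ⊓ p.1.2.1) ⊔ Submodule.span k {x}).comap H.subtype) (by
        rintro ⟨⟨⟨N, hN, hNH⟩, ⟨N', hN', hNH'⟩⟩, hne⟩ htop
        rw [Submodule.comap_subtype_eq_top] at htop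
        have h1 : Module.finrank k H ≤
            Module.finrank k (N ⊓ N' ⊔ Submodule.span k {x} : Submodule k (Fin 4 → k)) :=
          Submodule.finrank_mono htop
        have h2 := Submodule.finrank_add_le_finrank_add_finrank (N ⊓ N') (Submodule.span k {x})
        have h3 := finrank_span_le_card (R := k) ({x} : Set (Fin 4 → k))
        have h4 : Module.finrank k (N ⊓ N' : Submodule k (Fin 4 → k)) ≤ 1 := by
          by_cases hb : N ⊓ N' = ⊥
          · rw [hb, finrank_bot]; exact Nat.zero_le _
          · exact (finrank_inf_eq_one hN.1 hN'.1 hne hb).le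
        rw [Set.toFinset_singleton, Finset.card_singleton] at h3
        omega)
    exact ⟨w, w.2, fun N N' hN hN' hne ↦ hw ⟨⟨⟨N, hN⟩, ⟨N', hN'⟩⟩, hne⟩⟩
  obtain ⟨A, hA, hAroot⟩ := exists_finset_eval_smul_add x w f hf.2.1 hx
  have hex : ∀ N, IsLineOn f N ∧ N ≤ H → ∃ t : k, t • x + w ∈ N := by
    rintro N ⟨hN, hNH⟩
    have hlt : N < N ⊔ Submodule.span k {x} := lt_of_le_of_ne le_sup_left fun heq ↦
      hx (hN.2 x (heq ▸ Submodule.mem_sup_right (Submodule.mem_span_singleton_self x)))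
    have hHle : N ⊔ Submodule.span k {x} = H := by
      refine Submodule.eq_of_le_of_finrank_le (sup_le hNH ?_) ?_
      · simpa using hxH
      · have := Submodule.finrank_lt_finrank_of_lt hlt
        have := hN.1
        omega
    obtain ⟨n, hn, z, hz, hnz⟩ := Submodule.mem_sup.1 (hHle ▸ hwH)
    obtain ⟨c, rfl⟩ := Submodule.mem_span_singleton.1 hz
    refine ⟨-c, ?_⟩
    rw [← hnz]
    simpa using hn
  choose! t ht using hex
  refine le_trans ?_ hA
  rw [← Set.ncard_coe_finset]
  refine Set.ncard_le_ncard_of_injOn t (fun N hN ↦ hAroot _ (hN.1.2 _ (ht N hN))) ?_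
    A.finite_toSet
  intro N hN N' hN' htt
  by_contra hne
  refine hw N N' hN hN' hne (Submodule.mem_sup.2 ⟨t N • x + w, ⟨ht N hN, ?_⟩, -t N • x,
    Submodule.mem_span_singleton.2 ⟨_, rfl⟩, by simp⟩)
  rw [htt]
  exact ht N' hN'

/-- Three distinct pairwise meeting lines on a smooth surface are coplanar. -/
theorem IsSmoothSurface.le_sup_of_meet {k : Type*} [Field k] [Infinite k] {d : ℕ}
    {f : MvPolynomial (Fin 4) k} (hf : IsSmoothSurface f d) {L N N' : Submodule k (Fin 4 → k)}
    (hL : IsLineOn f L) (hN : IsLineOn f N) (hN' : IsLineOn f N') (hLN : L ≠ N)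
    (h₁ : L ⊓ N ≠ ⊥) (h₂ : N' ⊓ L ≠ ⊥) (h₃ : N' ⊓ N ≠ ⊥) : N' ≤ L ⊔ N := by
  obtain ⟨p, ⟨hpL, hpN⟩, hp0⟩ := Submodule.exists_mem_ne_zero_of_ne_bot h₁
  by_cases hp : p ∈ N'
  · have h3 := finrank_sup_eq_three hL.1 hN.1 hLN h₁
    have h4 : L ⊔ N = tangentSpace f p := Submodule.eq_of_le_of_finrank_le
      (sup_le (hL.le_tangentSpace hpL) (hN.le_tangentSpace hpN))
      (h3 ▸ hf.finrank_tangentSpace_le hp0 (hL.2 p hpL))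
    exact h4 ▸ hN'.le_tangentSpace hp
  · obtain ⟨q, ⟨hqN', hqL⟩, hq0⟩ := Submodule.exists_mem_ne_zero_of_ne_bot h₂
    obtain ⟨r, ⟨hrN', hrN⟩, hr0⟩ := Submodule.exists_mem_ne_zero_of_ne_bot h₃
    have hqN : q ∉ N := by
      intro hqN
      have h1 := finrank_inf_eq_one hL.1 hN.1 hLN h₁
      obtain ⟨c, hc⟩ := (finrank_eq_one_iff_of_nonzero' (⟨q, hqL, hqN⟩ : (L ⊓ N : Submodule k _))
        fun h0 ↦ hq0 (congrArg Subtype.val h0)).1 h1 ⟨p, hpL, hpN⟩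
      refine hp ?_
      rw [← show c • q = p from congrArg Subtype.val hc]
      exact N'.smul_mem _ hqN'
    have hspan := eq_span_pair hN'.1 hqN' hrN' fun a b hab ↦ by
      have ha : a = 0 := by
        by_contra ha
        refine hqN ?_
        have : q = (-(a⁻¹ * b)) • r := by
          rw [neg_smul, mul_smul, eq_neg_of_add_eq_zero_right hab, smul_neg, neg_neg, smul_smul,
            inv_mul_cancel₀ ha, one_smul]
        rw [this]
        exact N.smul_mem _ hrN
      refine ⟨ha, ?_⟩
      simpa [ha, hr0] using hab
    rw [hspan, Submodule.span_le]
    rintro x (rfl | rfl)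
    · exact Submodule.mem_sup_left hqL
    · exact Submodule.mem_sup_right hrN

theorem ncard_common_meeting_lines_add_two_le {k : Type*} [Field k] [IsAlgClosed k] {d : ℕ}
    (hd : 2 ≤ d) {f : MvPolynomial (Fin 4) k} (hf : IsSmoothSurface f d)
    (hfin : {N | IsLineOn f N}.Finite) {L N : Submodule k (Fin 4 → k)}
    (hL : IsLineOn f L) (hN : IsLineOn f N) (hLN : L ≠ N) (h : L ⊓ N ≠ ⊥) :
    {N' | IsLineOn f N' ∧ (N' ≠ L ∧ N' ⊓ L ≠ ⊥) ∧ (N' ≠ N ∧ N' ⊓ N ≠ ⊥)}.ncard + 2 ≤ d := by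
  have : Infinite k := IsAlgClosed.instInfinite
  have hfin' : {N' | IsLineOn f N' ∧ (N' ≠ L ∧ N' ⊓ L ≠ ⊥) ∧ (N' ≠ N ∧ N' ⊓ N ≠ ⊥)}.Finite :=
    hfin.subset fun N hN ↦ hN.1
  refine le_trans ?_ (ncard_lines_le_plane hd hf hfin (L ⊔ N)
    (finrank_sup_eq_three hL.1 hN.1 hLN h))
  rw [← Set.ncard_pair hLN, ← Set.ncard_union_eq ?_ hfin' (Set.toFinite _)]
  · refine Set.ncard_le_ncard ?_ (hfin.subset fun N hN ↦ hN.1)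
    rintro N' (⟨h1, h2, h3⟩ | rfl | rfl)
    · exact ⟨h1, hf.le_sup_of_meet hL hN h1 hLN h h2.2 h3.2⟩
    · exact ⟨hL, le_sup_left⟩
    · exact ⟨hN, le_sup_right⟩
  · rw [Set.disjoint_left]
    rintro N' ⟨-, h2, h3⟩ (rfl | rfl)
    · exact h2.1 rfl
    · exact h3.1 rfl

/-- Two distinct common transversals of two skew lines on a smooth surface are skew. -/
theorem IsSmoothSurface.inf_eq_bot_of_transversals {k : Type*} [Field k] [Infinite k] {d : ℕ}
    {f : MvPolynomial (Fin 4) k} (hf : IsSmoothSurface f d)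
    {L₁ L₂ M M' : Submodule k (Fin 4 → k)} (h₁ : IsLineOn f L₁) (h₂ : IsLineOn f L₂)
    (hM : IsLineOn f M) (hM' : IsLineOn f M') (h : L₁ ⊓ L₂ = ⊥) (hne : M ≠ M')
    (h1M : L₁ ⊓ M ≠ ⊥) (h2M : L₂ ⊓ M ≠ ⊥) (h1M' : L₁ ⊓ M' ≠ ⊥) (h2M' : L₂ ⊓ M' ≠ ⊥) :
    M ⊓ M' = ⊥ := by
  by_contra hMM
  have h3 := finrank_sup_eq_three hM.1 hM'.1 hne hMM
  have h4 := Submodule.finrank_mono (sup_le (hf.le_sup_of_meet hM hM' h₁ hne hMM h1M h1M')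
    (hf.le_sup_of_meet hM hM' h₂ hne hMM h2M h2M'))
  have h5 := Submodule.finrank_sup_add_finrank_inf_eq L₁ L₂
  rw [h, finrank_bot, h₁.1, h₂.1] at h5
  omega

theorem card_neighborFinset_eq_of_adj {V : Type*} [Fintype V] [DecidableEq V] (G : SimpleGraph V)
    [DecidableRel G.Adj] {a m : V} (ham : G.Adj a m) :
    (G.neighborFinset m).card = (G.neighborFinset a ∩ G.neighborFinset m).card + 1 +
      (G.neighborFinset m \ insert a (G.neighborFinset a)).card := by
  rw [← Finset.card_sdiff_add_card_inter (G.neighborFinset m) (insert a (G.neighborFinset a)),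
    Finset.inter_insert_of_mem (by simpa using ham.symm), Finset.card_insert_of_notMem (by simp),
    Finset.inter_comm]
  omega

theorem sum_card_sdiff_eq {V : Type*} [Fintype V] [DecidableEq V] (G : SimpleGraph V)
    [DecidableRel G.Adj] (a : V) :
    ∑ m ∈ G.neighborFinset a, (G.neighborFinset m \ insert a (G.neighborFinset a)).card =
      ∑ x ∈ (insert a (G.neighborFinset a))ᶜ, (G.neighborFinset a ∩ G.neighborFinset x).card := by
  convert Finset.sum_card_bipartiteAbove_eq_sum_card_bipartiteBelow (s := G.neighborFinset a)
    (t := (insert a (G.neighborFinset a))ᶜ) G.Adj using 3 with m hm x hx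
  · ext x
    simp [Finset.mem_bipartiteAbove, and_comm]
  · ext m
    simp [Finset.mem_bipartiteBelow, G.adj_comm x m]

/-- Extremal values of the degree and of the numbers of common neighbours force a graph to be
strongly regular. -/
theorem strongly_regular_of_bounds {V : Type*} [Fintype V] [DecidableEq V] (G : SimpleGraph V)
    [DecidableRel G.Adj] {s : ℕ} (hcard : Fintype.card V = s ^ 4 + s ^ 3 + s + 1)
    (hdeg : ∀ a, s ^ 3 + s ≤ (G.neighborFinset a).card)
    (hadj : ∀ a b, G.Adj a b → (G.neighborFinset a ∩ G.neighborFinset b).card + 1 ≤ s)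
    (hnadj : ∀ a b, a ≠ b → ¬ G.Adj a b →
      (G.neighborFinset a ∩ G.neighborFinset b).card ≤ s ^ 2 + 1) :
    (∀ a, (G.neighborFinset a).card = s ^ 3 + s) ∧
    (∀ a b, G.Adj a b → (G.neighborFinset a ∩ G.neighborFinset b).card + 1 = s) ∧
    ∀ a b, a ≠ b → ¬ G.Adj a b →
      (G.neighborFinset a ∩ G.neighborFinset b).card = s ^ 2 + 1 := by
  have hlow : ∀ a, ∀ m ∈ G.neighborFinset a,
      s ^ 3 ≤ (G.neighborFinset m \ insert a (G.neighborFinset a)).card := by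
    intro a m hm
    have ham : G.Adj a m := by simpa using hm
    have h1 := card_neighborFinset_eq_of_adj G ham
    have h2 := hadj a m ham
    have h3 := hdeg m
    omega
  have hup : ∀ a, ∀ x ∈ (insert a (G.neighborFinset a))ᶜ,
      (G.neighborFinset a ∩ G.neighborFinset x).card ≤ s ^ 2 + 1 := by
    intro a x hx
    simp only [Finset.mem_compl, Finset.mem_insert, not_or, SimpleGraph.mem_neighborFinset] at hx
    exact hnadj a x (Ne.symm hx.1) hx.2
  have hcompl : ∀ a, (insert a (G.neighborFinset a))ᶜ.card + (G.neighborFinset a).card =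
      s ^ 4 + s ^ 3 + s := by
    intro a
    have h1 := Finset.card_add_card_compl (insert a (G.neighborFinset a))
    rw [Finset.card_insert_of_notMem (by simp), hcard] at h1
    omega
  have hreg : ∀ a, (G.neighborFinset a).card = s ^ 3 + s := by
    intro a
    have h1 := Finset.card_nsmul_le_sum _ _ _ (hlow a)
    have h2 := Finset.sum_le_card_nsmul _ _ _ (hup a)
    rw [← sum_card_sdiff_eq, smul_eq_mul] at h2
    rw [smul_eq_mul] at h1
    have h3 := h1.trans h2
    obtain ⟨δ, hδ⟩ := Nat.exists_eq_add_of_le (hdeg a)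
    have h4 := hcompl a
    obtain ⟨r, hr⟩ : ∃ r, (insert a (G.neighborFinset a))ᶜ.card = r := ⟨_, rfl⟩
    rw [hr] at h3 h4
    rw [hδ] at h3 h4 ⊢
    have h5 : r + δ = s ^ 4 := by omega
    have h6 : δ * (s ^ 3 + s ^ 2 + 1) ≤ 0 := by
      have : r * (s ^ 2 + 1) + δ * (s ^ 2 + 1) = s ^ 4 * (s ^ 2 + 1) := by rw [← add_mul, h5]
      nlinarith
    have h7 : δ = 0 := by
      rcases Nat.mul_eq_zero.1 (Nat.le_zero.1 h6) with h | h
      · exact h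
      · omega
    rw [h7, add_zero]
  have hR : ∀ a, (insert a (G.neighborFinset a))ᶜ.card = s ^ 4 := by
    intro a
    have := hcompl a
    rw [hreg a] at this
    omega
  have heq : ∀ a, ∑ m ∈ G.neighborFinset a,
        (G.neighborFinset m \ insert a (G.neighborFinset a)).card = s ^ 4 * (s ^ 2 + 1) := by
    intro a
    refine le_antisymm ?_ ?_
    · rw [sum_card_sdiff_eq]
      exact (Finset.sum_le_card_nsmul _ _ _ (hup a)).trans_eq (by rw [hR, smul_eq_mul])
    · refine le_trans (le_of_eq ?_) (Finset.card_nsmul_le_sum _ _ _ (hlow a))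
      rw [hreg, smul_eq_mul]
      ring
  refine ⟨hreg, fun a b hab ↦ ?_, fun a b hne hab ↦ ?_⟩
  · have h1 := (Finset.sum_eq_sum_iff_of_le (hlow a)).1 (by
      rw [heq, Finset.sum_const, hreg, smul_eq_mul]; ring) b (by simpa using hab)
    have h2 := card_neighborFinset_eq_of_adj G hab
    rw [hreg, ← h1] at h2
    omega
  · have h1 := heq a
    rw [sum_card_sdiff_eq] at h1
    exact (Finset.sum_eq_sum_iff_of_le (hup a)).1 (by
      rw [h1, Finset.sum_const, hR, smul_eq_mul]) b (by simp [hne.symm, hab])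

/-- In a strongly regular graph with these parameters whose sets of common neighbours of two
non-adjacent vertices are independent, three pairwise non-adjacent vertices have exactly `s + 1`
common neighbours. -/
theorem card_common_neighbors_of_independent_triple {V : Type*} [Fintype V] [DecidableEq V]
    (G : SimpleGraph V) [DecidableRel G.Adj] {s : ℕ}
    (hcard : Fintype.card V = s ^ 4 + s ^ 3 + s + 1)
    (hreg : ∀ a, (G.neighborFinset a).card = s ^ 3 + s)
    (hadj : ∀ a b, G.Adj a b → (G.neighborFinset a ∩ G.neighborFinset b).card + 1 = s)
    (hnadj : ∀ a b, a ≠ b → ¬ G.Adj a b →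
      (G.neighborFinset a ∩ G.neighborFinset b).card = s ^ 2 + 1)
    (hind : ∀ a b m m', a ≠ b → ¬ G.Adj a b → G.Adj a m → G.Adj b m → G.Adj a m' → G.Adj b m' →
      ¬ G.Adj m m')
    {a b c : V} (hab : a ≠ b) (hab' : ¬ G.Adj a b) (hac : a ≠ c) (hac' : ¬ G.Adj a c)
    (hbc : b ≠ c) (hbc' : ¬ G.Adj b c) :
    (G.neighborFinset a ∩ G.neighborFinset b ∩ G.neighborFinset c).card = s + 1 := by
  obtain ⟨B, hB⟩ : ∃ B, B = G.neighborFinset a ∩ G.neighborFinset b := ⟨_, rfl⟩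
  obtain ⟨T, hT⟩ : ∃ T, T = (insert a (insert b (G.neighborFinset a ∪ G.neighborFinset b)))ᶜ :=
    ⟨_, rfl⟩
  have hmemB : ∀ m, m ∈ B ↔ G.Adj a m ∧ G.Adj b m := fun m ↦ by simp [hB]
  have hmemT : ∀ x, x ∈ T ↔ (x ≠ a ∧ x ≠ b) ∧ ¬ G.Adj a x ∧ ¬ G.Adj b x := fun x ↦ by
    simp [hT, and_assoc]
  have hBcard : (B.card : ℤ) = s ^ 2 + 1 := by
    rw [hB]; exact_mod_cast hnadj a b hab hab'
  have hTcard : (T.card : ℤ) = s ^ 4 - s ^ 3 + s ^ 2 - s := by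
    have h1 := Finset.card_add_card_compl
      (insert a (insert b (G.neighborFinset a ∪ G.neighborFinset b)))
    rw [Finset.card_insert_of_notMem (by simp [hab, hab', G.adj_comm b a]),
      Finset.card_insert_of_notMem (by simp [hab']), hcard, ← hT] at h1
    have h2 := Finset.card_union_add_card_inter (G.neighborFinset a) (G.neighborFinset b)
    rw [hnadj a b hab hab', hreg, hreg] at h2
    zify at h1 h2
    linarith
  have hdiag : ∀ m ∈ B, ((T.filter (G.Adj m)).card : ℤ) = s ^ 3 - s := by
    intro m hm
    obtain ⟨ham, hbm⟩ := (hmemB m).1 hm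
    have h1 : G.neighborFinset m = insert a (insert b
        ((G.neighborFinset a ∩ G.neighborFinset m ∪ G.neighborFinset b ∩ G.neighborFinset m) ∪
          T.filter (G.Adj m))) := by
      ext x
      simp only [SimpleGraph.mem_neighborFinset, Finset.mem_insert, Finset.mem_union,
        Finset.mem_inter, Finset.mem_filter, hmemT]
      by_cases hxa : x = a
      · simp [hxa, ham.symm]
      by_cases hxb : x = b
      · simp [hxb, hbm.symm]
      tauto
    have h2 : Disjoint (G.neighborFinset a ∩ G.neighborFinset m)
        (G.neighborFinset b ∩ G.neighborFinset m) := by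
      rw [Finset.disjoint_left]
      intro x hx hx'
      simp only [SimpleGraph.mem_neighborFinset, Finset.mem_inter] at hx hx'
      exact hind a b m x hab hab' ham hbm hx.1 hx'.1 hx.2
    have h3 : Disjoint
        (G.neighborFinset a ∩ G.neighborFinset m ∪ G.neighborFinset b ∩ G.neighborFinset m)
        (T.filter (G.Adj m)) := by
      rw [Finset.disjoint_left]
      intro x hx hx'
      simp only [SimpleGraph.mem_neighborFinset, Finset.mem_inter, Finset.mem_union,
        Finset.mem_filter, hmemT] at hx hx'
      tauto
    have h4 := congrArg Finset.card h1
    rw [Finset.card_insert_of_notMem (by simp [hab, hab', G.adj_comm b a, hmemT]),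
      Finset.card_insert_of_notMem (by simp [hab', hmemT]), Finset.card_union_of_disjoint h3,
      Finset.card_union_of_disjoint h2, hreg] at h4
    have h5 := hadj a m ham
    have h6 := hadj b m hbm
    zify at h4 h5 h6
    linarith
  have hoff : ∀ m ∈ B, ∀ m' ∈ B, m ≠ m' →
      ((T.filter fun x ↦ G.Adj m x ∧ G.Adj m' x).card : ℤ) = s ^ 2 - 1 := by
    intro m hm m' hm' hne
    obtain ⟨ham, hbm⟩ := (hmemB m).1 hm
    obtain ⟨ham', hbm'⟩ := (hmemB m').1 hm'
    have hmm : ¬ G.Adj m m' := hind a b m m' hab hab' ham hbm ham' hbm'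
    have h1 : G.neighborFinset m ∩ G.neighborFinset m' = insert a (insert b
        (T.filter fun x ↦ G.Adj m x ∧ G.Adj m' x)) := by
      ext x
      simp only [SimpleGraph.mem_neighborFinset, Finset.mem_insert,
        Finset.mem_inter, Finset.mem_filter, hmemT]
      by_cases hxa : x = a
      · simp [hxa, ham.symm, ham'.symm]
      by_cases hxb : x = b
      · simp [hxb, hbm.symm, hbm'.symm]
      have := fun h h' ↦ hind m m' a x hne hmm ham.symm ham'.symm h h'
      have := fun h h' ↦ hind m m' b x hne hmm hbm.symm hbm'.symm h h'
      tauto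
    have h4 := congrArg Finset.card h1
    rw [Finset.card_insert_of_notMem (by simp [hab, hmemT]),
      Finset.card_insert_of_notMem (by simp [hmemT]), hnadj m m' hne hmm] at h4
    zify at h4
    linarith
  obtain ⟨r, hr⟩ : ∃ r : V → ℤ, ∀ x, r x = ∑ m ∈ B, if G.Adj m x then 1 else 0 :=
    ⟨_, fun _ ↦ rfl⟩
  have hsum₁ : ∑ x ∈ T, r x = (s ^ 2 + 1) * (s ^ 3 - s) := by
    simp_rw [hr]
    rw [Finset.sum_comm, ← hBcard, ← nsmul_eq_mul, ← Finset.sum_const]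
    refine Finset.sum_congr rfl fun m hm ↦ ?_
    rw [← hdiag m hm, Finset.sum_boole]
  have hsum₂ : ∑ x ∈ T, r x * r x =
      (s ^ 2 + 1) * ((s ^ 3 - s) + s ^ 2 * (s ^ 2 - 1)) := by
    simp_rw [hr, Finset.sum_mul_sum]
    rw [Finset.sum_comm, ← hBcard, ← nsmul_eq_mul, ← Finset.sum_const]
    refine Finset.sum_congr rfl fun m hm ↦ ?_
    rw [Finset.sum_comm, ← Finset.add_sum_erase _ _ hm]
    congr 1
    · rw [← hdiag m hm, ← Finset.sum_boole]
      refine Finset.sum_congr rfl fun x _ ↦ by split_ifs <;> simp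
    · have h1 : ((B.erase m).card : ℤ) = s ^ 2 := by
        have := Finset.card_erase_add_one hm
        zify at this
        linarith
      rw [show (s : ℤ) ^ 2 * (s ^ 2 - 1) = (B.erase m).card • ((s : ℤ) ^ 2 - 1) by
        rw [nsmul_eq_mul, h1], ← Finset.sum_const]
      refine Finset.sum_congr rfl fun m' hm' ↦ ?_
      rw [← hoff m hm m' (Finset.mem_of_mem_erase hm') (Finset.ne_of_mem_erase hm').symm,
        ← Finset.sum_boole]
      refine Finset.sum_congr rfl fun x _ ↦ by split_ifs <;> simp_all
  have hzero : ∑ x ∈ T, (r x - (s + 1)) ^ 2 = 0 := by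
    have : ∀ x, (r x - (s + 1)) ^ 2 = r x * r x - 2 * (s + 1) * r x + (s + 1) ^ 2 := fun x ↦ by
      ring
    simp_rw [this]
    rw [Finset.sum_add_distrib, Finset.sum_sub_distrib, ← Finset.mul_sum, hsum₁, hsum₂,
      Finset.sum_const, nsmul_eq_mul, hTcard]
    ring
  have hc := (Finset.sum_eq_zero_iff_of_nonneg fun x _ ↦ sq_nonneg _).1 hzero c
    ((hmemT c).2 ⟨⟨hac.symm, hbc.symm⟩, hac', hbc'⟩)
  have hc' : r c = s + 1 := by
    have := pow_eq_zero_iff two_ne_zero |>.1 hc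
    linarith
  rw [hr, Finset.sum_boole] at hc'
  have : G.neighborFinset a ∩ G.neighborFinset b ∩ G.neighborFinset c =
      B.filter fun m ↦ G.Adj m c := by
    ext m
    simp [hB, G.adj_comm m c, and_assoc]
  rw [this]
  exact_mod_cast hc'

theorem pair_independent_of_disjoint {k V : Type*} [Field k] [AddCommGroup V] [Module k V]
    {A B : Submodule k V} (hAB : A ⊓ B = ⊥) {p q : V} (hp : p ∈ A) (hq : q ∈ B) (hp0 : p ≠ 0)
    (hq0 : q ≠ 0) (a b : k) (h : a • p + b • q = 0) : a = 0 ∧ b = 0 := by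
  have h1 : a • p = 0 := by
    rw [← Submodule.mem_bot k, ← hAB]
    refine ⟨A.smul_mem _ hp, ?_⟩
    rw [eq_neg_of_add_eq_zero_left h]
    exact B.neg_mem (B.smul_mem _ hq)
  rw [h1, zero_add] at h
  exact ⟨(smul_eq_zero.1 h1).resolve_right hp0, (smul_eq_zero.1 h).resolve_right hq0⟩

/-- A common transversal of three pairwise skew lines is spanned by points `p` and `q` of the
first two lines whose sum is on the third one. -/
theorem exists_mem_of_transversal {k V : Type*} [Field k] [AddCommGroup V] [Module k V]
    [FiniteDimensional k V] {L₁ L₂ L₃ M : Submodule k V} (h₁₂ : L₁ ⊓ L₂ = ⊥) (h₁₃ : L₁ ⊓ L₃ = ⊥)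
    (h₂₃ : L₂ ⊓ L₃ = ⊥) (hM : Module.finrank k M = 2) (h₁ : M ⊓ L₁ ≠ ⊥) (h₂ : M ⊓ L₂ ≠ ⊥)
    (h₃ : M ⊓ L₃ ≠ ⊥) :
    ∃ p q, p ∈ L₁ ∧ q ∈ L₂ ∧ p ∈ M ∧ q ∈ M ∧ p ≠ 0 ∧ q ≠ 0 ∧ p + q ∈ L₃ := by
  obtain ⟨p, ⟨hpM, hpL⟩, hp0⟩ := Submodule.exists_mem_ne_zero_of_ne_bot h₁
  obtain ⟨q, ⟨hqM, hqL⟩, hq0⟩ := Submodule.exists_mem_ne_zero_of_ne_bot h₂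
  obtain ⟨r, ⟨hrM, hrL⟩, hr0⟩ := Submodule.exists_mem_ne_zero_of_ne_bot h₃
  have hspan := eq_span_pair hM hpM hqM (pair_independent_of_disjoint h₁₂ hpL hqL hp0 hq0)
  rw [hspan] at hrM
  obtain ⟨a, b, rfl⟩ := Submodule.mem_span_pair.1 hrM
  refine ⟨a • p, b • q, L₁.smul_mem _ hpL, L₂.smul_mem _ hqL, M.smul_mem _ hpM, M.smul_mem _ hqM,
    fun h ↦ ?_, fun h ↦ ?_, hrL⟩
  · rw [h, zero_add] at hrL hr0
    exact hr0 ((Submodule.mem_bot k).1 (h₂₃ ▸ ⟨L₂.smul_mem _ hqL, hrL⟩))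
  · rw [h, add_zero] at hrL hr0
    exact hr0 ((Submodule.mem_bot k).1 (h₁₃ ▸ ⟨L₁.smul_mem _ hpL, hrL⟩))

theorem exists_coordinates_of_transversal {k V : Type*} [Field k] [AddCommGroup V] [Module k V]
    [FiniteDimensional k V] {p₁ p₂ q₁ q₂ : V} {M : Submodule k V}
    (hind : ∀ a b c e : k, a • p₁ + b • p₂ + (c • q₁ + e • q₂) = 0 →
      a = 0 ∧ b = 0 ∧ c = 0 ∧ e = 0)
    (hM : Module.finrank k M = 2) (h₁ : M ⊓ Submodule.span k {p₁, p₂} ≠ ⊥)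
    (h₂ : M ⊓ Submodule.span k {q₁, q₂} ≠ ⊥)
    (h₃ : M ⊓ Submodule.span k {p₁ + q₁, p₂ + q₂} ≠ ⊥) :
    ∃ x y : k, ¬ (x = 0 ∧ y = 0) ∧ x • p₁ + y • p₂ ∈ M ∧ x • q₁ + y • q₂ ∈ M := by
  obtain ⟨u, ⟨huM, hu⟩, hu0⟩ := Submodule.exists_mem_ne_zero_of_ne_bot h₁
  obtain ⟨v, ⟨hvM, hv⟩, hv0⟩ := Submodule.exists_mem_ne_zero_of_ne_bot h₂
  obtain ⟨r, ⟨hrM, hr⟩, hr0⟩ := Submodule.exists_mem_ne_zero_of_ne_bot h₃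
  have hdisj : Submodule.span k {p₁, p₂} ⊓ Submodule.span k {q₁, q₂} = ⊥ := by
    rw [eq_bot_iff]
    rintro w ⟨hw, hw'⟩
    obtain ⟨a, b, rfl⟩ := Submodule.mem_span_pair.1 hw
    obtain ⟨c, e, hce⟩ := Submodule.mem_span_pair.1 hw'
    obtain ⟨rfl, rfl, -⟩ := hind a b (-c) (-e) (by rw [← hce]; module)
    simp
  have hspan := eq_span_pair hM huM hvM (pair_independent_of_disjoint hdisj hu hv hu0 hv0)
  obtain ⟨s, t, hst⟩ := Submodule.mem_span_pair.1 (hspan ▸ hrM)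
  obtain ⟨u₁, u₂, hu'⟩ := Submodule.mem_span_pair.1 hu
  obtain ⟨v₁, v₂, hv'⟩ := Submodule.mem_span_pair.1 hv
  obtain ⟨x, y, hxy⟩ := Submodule.mem_span_pair.1 hr
  obtain ⟨e1, e2, e3, e4⟩ := hind (x - s * u₁) (y - s * u₂) (x - t * v₁) (y - t * v₂) <| by
    rw [← sub_eq_zero.2 (hxy.trans hst.symm), ← hu', ← hv']
    module
  refine ⟨x, y, ?_, ?_, ?_⟩
  · rintro ⟨rfl, rfl⟩
    exact hr0 (by rw [← hxy]; simp)
  · have : x • p₁ + y • p₂ = s • u := by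
      rw [← hu', sub_eq_zero.1 e1, sub_eq_zero.1 e2]; module
    exact this ▸ M.smul_mem _ huM
  · have : x • q₁ + y • q₂ = t • v := by
      rw [← hv', sub_eq_zero.1 e3, sub_eq_zero.1 e4]; module
    exact this ▸ M.smul_mem _ hvM

/-- Two lines, one meeting three pairwise skew lines and the other one meeting three pairwise
skew transversals of these, meet each other: they are in the two rulings of a quadric. -/
theorem inf_ne_bot_of_transversals {k V : Type*} [Field k] [AddCommGroup V] [Module k V]
    [FiniteDimensional k V] {L₁ L₂ L₃ M₁ M₂ M₃ L M : Submodule k V}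
    (hL₁ : Module.finrank k L₁ = 2) (hL₂ : Module.finrank k L₂ = 2)
    (hL₃ : Module.finrank k L₃ = 2) (hM₁ : Module.finrank k M₁ = 2)
    (hM₂ : Module.finrank k M₂ = 2) (hM₃ : Module.finrank k M₃ = 2)
    (hL : Module.finrank k L = 2) (hM : Module.finrank k M = 2)
    (hL₁₂ : L₁ ⊓ L₂ = ⊥) (hL₁₃ : L₁ ⊓ L₃ = ⊥) (hL₂₃ : L₂ ⊓ L₃ = ⊥)
    (hM₁₂ : M₁ ⊓ M₂ = ⊥) (hM₁₃ : M₁ ⊓ M₃ = ⊥) (hM₂₃ : M₂ ⊓ M₃ = ⊥)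
    (h₁₁ : M₁ ⊓ L₁ ≠ ⊥) (h₁₂ : M₁ ⊓ L₂ ≠ ⊥) (h₁₃ : M₁ ⊓ L₃ ≠ ⊥)
    (h₂₁ : M₂ ⊓ L₁ ≠ ⊥) (h₂₂ : M₂ ⊓ L₂ ≠ ⊥) (h₂₃ : M₂ ⊓ L₃ ≠ ⊥)
    (h₃₁ : M₃ ⊓ L₁ ≠ ⊥) (h₃₂ : M₃ ⊓ L₂ ≠ ⊥) (h₃₃ : M₃ ⊓ L₃ ≠ ⊥)
    (h₁ : M ⊓ L₁ ≠ ⊥) (h₂ : M ⊓ L₂ ≠ ⊥) (h₃ : M ⊓ L₃ ≠ ⊥)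
    (h₁' : L ⊓ M₁ ≠ ⊥) (h₂' : L ⊓ M₂ ≠ ⊥) (h₃' : L ⊓ M₃ ≠ ⊥) : L ⊓ M ≠ ⊥ := by
  obtain ⟨p₁, q₁, hp₁, hq₁, hp₁M, hq₁M, hp₁0, hq₁0, hr₁⟩ :=
    exists_mem_of_transversal hL₁₂ hL₁₃ hL₂₃ hM₁ h₁₁ h₁₂ h₁₃
  obtain ⟨p₂, q₂, hp₂, hq₂, hp₂M, hq₂M, hp₂0, hq₂0, hr₂⟩ :=
    exists_mem_of_transversal hL₁₂ hL₁₃ hL₂₃ hM₂ h₂₁ h₂₂ h₂₃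
  have hp := pair_independent_of_disjoint hM₁₂ hp₁M hp₂M hp₁0 hp₂0
  have hq := pair_independent_of_disjoint hM₁₂ hq₁M hq₂M hq₁0 hq₂0
  have hind : ∀ a b c e : k, a • p₁ + b • p₂ + (c • q₁ + e • q₂) = 0 →
      a = 0 ∧ b = 0 ∧ c = 0 ∧ e = 0 := by
    intro a b c e h
    have h1 : a • p₁ + b • p₂ = 0 := by
      rw [← Submodule.mem_bot k, ← hL₁₂]
      refine ⟨L₁.add_mem (L₁.smul_mem _ hp₁) (L₁.smul_mem _ hp₂), ?_⟩
      rw [eq_neg_of_add_eq_zero_left h]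
      exact L₂.neg_mem (L₂.add_mem (L₂.smul_mem _ hq₁) (L₂.smul_mem _ hq₂))
    rw [h1, zero_add] at h
    exact ⟨(hp a b h1).1, (hp a b h1).2, hq c e h⟩
  have hr : ∀ a b : k, a • (p₁ + q₁) + b • (p₂ + q₂) = 0 → a = 0 ∧ b = 0 := fun a b h ↦ by
    obtain ⟨h1, h2, -⟩ := hind a b a b (by rw [← h]; module)
    exact ⟨h1, h2⟩
  have hcoord : ∀ N : Submodule k V, Module.finrank k N = 2 → N ⊓ L₁ ≠ ⊥ → N ⊓ L₂ ≠ ⊥ →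
      N ⊓ L₃ ≠ ⊥ → ∃ x y : k, ¬ (x = 0 ∧ y = 0) ∧ x • p₁ + y • p₂ ∈ N ∧ x • q₁ + y • q₂ ∈ N := by
    intro N hN g₁ g₂ g₃
    rw [eq_span_pair hL₁ hp₁ hp₂ hp] at g₁
    rw [eq_span_pair hL₂ hq₁ hq₂ hq] at g₂
    rw [eq_span_pair hL₃ hr₁ hr₂ hr] at g₃
    exact exists_coordinates_of_transversal hind hN g₁ g₂ g₃
  obtain ⟨x, y, hxy, hx, hy⟩ := hcoord M₃ hM₃ h₃₁ h₃₂ h₃₃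
  obtain ⟨z, w, hzw, hz, hw⟩ := hcoord M hM h₁ h₂ h₃
  have hy0 : y ≠ 0 := by
    rintro rfl
    have hx0 : x ≠ 0 := fun h ↦ hxy ⟨h, rfl⟩
    have : x • p₁ ∈ M₁ ⊓ M₃ := ⟨M₁.smul_mem _ hp₁M, by simpa using hx⟩
    rw [hM₁₃, Submodule.mem_bot] at this
    exact smul_ne_zero hx0 hp₁0 this
  have hx0 : x ≠ 0 := by
    rintro rfl
    have : y • p₂ ∈ M₂ ⊓ M₃ := ⟨M₂.smul_mem _ hp₂M, by simpa using hx⟩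
    rw [hM₂₃, Submodule.mem_bot] at this
    exact smul_ne_zero hy0 hp₂0 this
  have hind' : ∀ a b c e : k, a • x • p₁ + b • x • q₁ + (c • y • p₂ + e • y • q₂) = 0 →
      a = 0 ∧ b = 0 ∧ c = 0 ∧ e = 0 := by
    intro a b c e h
    obtain ⟨e1, e2, e3, e4⟩ := hind (a * x) (c * y) (b * x) (e * y) (by rw [← h]; module)
    exact ⟨(mul_eq_zero.1 e1).resolve_right hx0, (mul_eq_zero.1 e3).resolve_right hx0,
      (mul_eq_zero.1 e2).resolve_right hy0, (mul_eq_zero.1 e4).resolve_right hy0⟩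
  rw [eq_span_pair hM₁ (M₁.smul_mem x hp₁M) (M₁.smul_mem x hq₁M) fun a b h ↦ by
    obtain ⟨e1, e2, -⟩ := hind' a b 0 0 (by rw [h]; simp)
    exact ⟨e1, e2⟩] at h₁'
  rw [eq_span_pair hM₂ (M₂.smul_mem y hp₂M) (M₂.smul_mem y hq₂M) fun a b h ↦
    (hind' 0 0 a b (by rw [h]; simp)).2.2] at h₂'
  rw [eq_span_pair hM₃ hx hy fun a b h ↦ by
    obtain ⟨e1, e2, -⟩ := hind' a b a b (by rw [← h]; module)
    exact ⟨e1, e2⟩] at h₃'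
  obtain ⟨u, v, huv, hu, hv⟩ := exists_coordinates_of_transversal hind' hL h₁' h₂' h₃'
  have hu' : u • p₁ + v • q₁ ∈ L := by
    rw [smul_comm u, smul_comm v, ← smul_add] at hu
    exact (L.smul_mem_iff hx0).1 hu
  have hv' : u • p₂ + v • q₂ ∈ L := by
    rw [smul_comm u, smul_comm v, ← smul_add] at hv
    exact (L.smul_mem_iff hy0).1 hv
  refine (Submodule.ne_bot_iff _).2 ⟨u • (z • p₁ + w • p₂) + v • (z • q₁ + w • q₂), ⟨?_,
    M.add_mem (M.smul_mem _ hz) (M.smul_mem _ hw)⟩, fun h ↦ ?_⟩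
  · have : u • (z • p₁ + w • p₂) + v • (z • q₁ + w • q₂) =
        z • (u • p₁ + v • q₁) + w • (u • p₂ + v • q₂) := by module
    rw [this]
    exact L.add_mem (L.smul_mem _ hu') (L.smul_mem _ hv')
  · obtain ⟨e1, e2, e3, e4⟩ := hind (u * z) (u * w) (v * z) (v * w) (by
      simpa only [smul_add, smul_smul] using h)
    refine hzw ?_
    by_cases hu0 : u = 0
    · have hv0 : v ≠ 0 := fun hv0 ↦ huv ⟨hu0, hv0⟩
      exact ⟨(mul_eq_zero.1 e3).resolve_left hv0, (mul_eq_zero.1 e4).resolve_left hv0⟩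
    · exact ⟨(mul_eq_zero.1 e1).resolve_left hu0, (mul_eq_zero.1 e2).resolve_left hu0⟩

theorem card_eq_ncard_of_mem_iff {α : Type*} {P Q : α → Prop} (F : Finset {x // Q x})
    (hF : ∀ x, x ∈ F ↔ P x.1) : F.card = {x | Q x ∧ P x}.ncard := by
  rw [← Set.ncard_coe_finset, ← Set.ncard_image_of_injective _ Subtype.val_injective]
  congr 1
  ext x
  constructor
  · rintro ⟨y, hy, rfl⟩
    exact ⟨y.2, (hF y).1 hy⟩
  · rintro ⟨hx, hx'⟩
    exact ⟨⟨x, hx⟩, (hF _).2 hx', rfl⟩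

/-- The graph of lines on `V(f)`, two lines being adjacent if they are distinct and meet. -/
def lineGraph {k : Type*} [Field k] (f : MvPolynomial (Fin 4) k) :
    SimpleGraph {N : Submodule k (Fin 4 → k) // IsLineOn f N} where
  Adj N N' := N' ≠ N ∧ N'.1 ⊓ N.1 ≠ ⊥
  symm := ⟨fun _ _ h ↦ ⟨h.1.symm, inf_comm (α := Submodule k (Fin 4 → k)) _ _ ▸ h.2⟩⟩
  loopless := ⟨fun _ h ↦ h.1 rfl⟩

/-- On a smooth surface of degree `d` with `d² (d² - 3d + 3)` lines, three pairwise skew lines have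
exactly `d` common transversals. -/
theorem ncard_common_transversals {k : Type*} [Field k] [IsAlgClosed k]
    {d : ℕ} (hd : 3 ≤ d) {f : MvPolynomial (Fin 4) k} (hf : IsSmoothSurface f d)
    (hcount : {W : Submodule k (Fin 4 → k) | IsLineOn f W}.ncard =
      d ^ 2 * (d ^ 2 - 3 * d + 3))
    {L₁ L₂ L₃ : Submodule k (Fin 4 → k)} (h1 : IsLineOn f L₁) (h2 : IsLineOn f L₂)
    (h3 : IsLineOn f L₃) (h12 : L₁ ≠ L₂) (h13 : L₁ ≠ L₃) (h23 : L₂ ≠ L₃)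
    (s12 : L₁ ⊓ L₂ = ⊥) (s13 : L₁ ⊓ L₃ = ⊥) (s23 : L₂ ⊓ L₃ = ⊥) :
    {N | IsLineOn f N ∧ N ⊓ L₁ ≠ ⊥ ∧ N ⊓ L₂ ≠ ⊥ ∧ N ⊓ L₃ ≠ ⊥}.ncard = d := by
  classical
  have : Infinite k := IsAlgClosed.instInfinite
  have hfin : {W : Submodule k (Fin 4 → k) | IsLineOn f W}.Finite :=
    Set.finite_of_ncard_ne_zero <| by
      rw [hcount]
      exact Nat.mul_ne_zero (pow_ne_zero _ (by omega)) (by omega)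
  have : Fintype {W : Submodule k (Fin 4 → k) // IsLineOn f W} := hfin.fintype
  obtain ⟨s, rfl⟩ : ∃ s, d = s + 1 := ⟨d - 1, by omega⟩
  have hcard : Fintype.card {W : Submodule k (Fin 4 → k) // IsLineOn f W} =
      s ^ 4 + s ^ 3 + s + 1 := by
    rw [← Finset.card_univ, card_eq_ncard_of_mem_iff (P := fun _ ↦ True) _ (by simp)]
    simp only [and_true]
    rw [hcount, show (s + 1) ^ 2 - 3 * (s + 1) + 3 = s ^ 2 - s + 1 by
      have : s ≤ s ^ 2 := Nat.le_self_pow two_ne_zero s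
      have : 3 * (s + 1) ≤ (s + 1) ^ 2 := by nlinarith
      zify [*]
      ring]
    have : s ≤ s ^ 2 := Nat.le_self_pow two_ne_zero s
    zify [this]
    ring
  have hne : ∀ {N N' : Submodule k (Fin 4 → k)}, IsLineOn f N → N ⊓ N' = ⊥ → N ≠ N' := by
    rintro N _ hN h rfl
    rw [inf_idem] at h
    have := hN.1
    rw [h, finrank_bot] at this
    omega
  have hmem : ∀ N N', N' ∈ (lineGraph f).neighborFinset N ↔ N' ≠ N ∧ N'.1 ⊓ N.1 ≠ ⊥ := fun N N' ↦
    SimpleGraph.mem_neighborFinset _ _ _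
  have hdeg : ∀ N, s ^ 3 + s ≤ ((lineGraph f).neighborFinset N).card := by
    intro N
    have e1 := Finset.card_add_card_compl (insert N ((lineGraph f).neighborFinset N))
    rw [Finset.card_insert_of_notMem (by simp), hcard] at e1
    have e2 := card_eq_ncard_of_mem_iff (P := fun N' ↦ N' ⊓ N.1 = ⊥)
      (insert N ((lineGraph f).neighborFinset N))ᶜ fun N' ↦ by
        rw [Finset.mem_compl, Finset.mem_insert, hmem]
        constructor
        · intro h
          by_contra h'
          exact h (or_iff_not_imp_left.2 fun h'' ↦ ⟨h'', h'⟩)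
        · rintro h (h' | h')
          · exact hne N'.2 h (congrArg Subtype.val h')
          · exact h'.2 h
    have e3 := ncard_lines_skew_le hd f hf.2.1 hfin N.1 N.2
    rw [← e2, Nat.add_sub_cancel] at e3
    omega
  have hadj : ∀ N N', (lineGraph f).Adj N N' →
      ((lineGraph f).neighborFinset N ∩ (lineGraph f).neighborFinset N').card + 1 ≤ s := by
    rintro N N' ⟨hNN, hmeet⟩
    have e1 := ncard_common_meeting_lines_add_two_le (by omega) hf hfin N'.2 N.2
      (fun h ↦ hNN (Subtype.ext h)) hmeet
    rw [← card_eq_ncard_of_mem_iff (P := fun M ↦ (M ≠ N'.1 ∧ M ⊓ N'.1 ≠ ⊥) ∧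
      (M ≠ N.1 ∧ M ⊓ N.1 ≠ ⊥)) ((lineGraph f).neighborFinset N ∩ (lineGraph f).neighborFinset N')
      fun M ↦ by
        simp only [Finset.mem_inter, hmem, ne_eq, Subtype.ext_iff]
        exact and_comm] at e1
    omega
  have hskew : ∀ {N N' : {W : Submodule k (Fin 4 → k) // IsLineOn f W}}, N ≠ N' →
      ¬ (lineGraph f).Adj N N' → N.1 ⊓ N'.1 = ⊥ := by
    intro N N' h h'
    by_contra hcon
    exact h' ⟨h.symm, by rwa [inf_comm]⟩
  have htrans : ∀ N N' : {W : Submodule k (Fin 4 → k) // IsLineOn f W}, N.1 ⊓ N'.1 = ⊥ →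
      ∀ M, M ∈ (lineGraph f).neighborFinset N ∩ (lineGraph f).neighborFinset N' ↔
        M.1 ⊓ N.1 ≠ ⊥ ∧ M.1 ⊓ N'.1 ≠ ⊥ := by
    intro N N' h M
    rw [Finset.mem_inter, hmem, hmem]
    refine ⟨fun hM ↦ ⟨hM.1.2, hM.2.2⟩, fun hM ↦ ⟨⟨?_, hM.1⟩, ?_, hM.2⟩⟩
    · rintro rfl
      exact hM.2 h
    · rintro rfl
      exact hM.1 (by rwa [inf_comm])
  have hnadj : ∀ N N', N ≠ N' → ¬ (lineGraph f).Adj N N' →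
      ((lineGraph f).neighborFinset N ∩ (lineGraph f).neighborFinset N').card ≤ s ^ 2 + 1 := by
    intro N N' h h'
    have e1 := ncard_transversals_le hd f hf hfin N.1 N'.1 N.2 N'.2 (hskew h h')
    rwa [← card_eq_ncard_of_mem_iff _ (htrans N N' (hskew h h')), Nat.add_sub_cancel] at e1
  obtain ⟨g1, g2, g3⟩ := strongly_regular_of_bounds (lineGraph f) hcard hdeg hadj hnadj
  have hnot : ∀ {N N' : Submodule k (Fin 4 → k)} (hN : IsLineOn f N) (hN' : IsLineOn f N'),
      N ⊓ N' = ⊥ → ¬ (lineGraph f).Adj ⟨N, hN⟩ ⟨N', hN'⟩ := fun _ _ h h' ↦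
    h'.2 (by rwa [inf_comm])
  have key := card_common_neighbors_of_independent_triple (lineGraph f) hcard g1 g2 g3
    (fun a b m m' hab hab' ham hbm ham' hbm' hmm' ↦ hmm'.2 <|
      hf.inf_eq_bot_of_transversals a.2 b.2 m'.2 m.2 (hskew hab hab')
        (fun h ↦ hmm'.1 (Subtype.ext h)) ham'.symm.2 hbm'.symm.2 ham.symm.2 hbm.symm.2)
    (a := ⟨L₁, h1⟩) (b := ⟨L₂, h2⟩) (c := ⟨L₃, h3⟩)
    (fun h ↦ h12 (congrArg Subtype.val h)) (hnot h1 h2 s12)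
    (fun h ↦ h13 (congrArg Subtype.val h)) (hnot h1 h3 s13)
    (fun h ↦ h23 (congrArg Subtype.val h)) (hnot h2 h3 s23)
  rw [card_eq_ncard_of_mem_iff (P := fun N ↦ N ⊓ L₁ ≠ ⊥ ∧ N ⊓ L₂ ≠ ⊥ ∧ N ⊓ L₃ ≠ ⊥)] at key
  · exact key
  · intro M
    rw [Finset.mem_inter, htrans ⟨L₁, h1⟩ ⟨L₂, h2⟩ s12, hmem]
    refine ⟨fun hM ↦ ⟨hM.1.1, hM.1.2, hM.2.2⟩, fun hM ↦ ⟨⟨hM.1, hM.2.1⟩, ?_, hM.2.2⟩⟩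
    rintro rfl
    exact hM.1 (by rwa [inf_comm])

theorem exists_enumeration {α : Type*} {d : ℕ} (hd : 3 ≤ d) (S : Set α) (hS : S.ncard = d)
    {a b c : α} (ha : a ∈ S) (hb : b ∈ S) (hc : c ∈ S) (hab : a ≠ b) (hac : a ≠ c) (hbc : b ≠ c) :
    ∃ g : Fin d → α, Function.Injective g ∧ Set.range g = S ∧ g ⟨0, by omega⟩ = a ∧
      g ⟨1, by omega⟩ = b ∧ g ⟨2, by omega⟩ = c := by
  classical
  have hfin : S.Finite := Set.finite_of_ncard_ne_zero (by omega)
  obtain ⟨g, hg⟩ := Set.MapsTo.exists_equiv_extend_of_card_eq (α := Fin d) (t := hfin.toFinset)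
    (by rw [Fintype.card_fin, ← Set.ncard_eq_toFinset_card S hfin, hS])
    (s := {i : Fin d | i.1 < 3}) (f := fun i ↦ if i.1 = 0 then a else if i.1 = 1 then b else c)
    (fun i _ ↦ by dsimp only; split_ifs <;> simpa)
    (fun i (hi : i.1 < 3) j (hj : j.1 < 3) hij ↦ by
      rw [Fin.ext_iff]
      dsimp only at hij
      split_ifs at hij <;> first | omega | simp_all)
  refine ⟨fun i ↦ g i, Subtype.val_injective.comp g.injective, ?_,
    hg ⟨0, by omega⟩ (show 0 < 3 by norm_num), hg ⟨1, by omega⟩ (show 1 < 3 by norm_num),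
    hg ⟨2, by omega⟩ (show 2 < 3 by norm_num)⟩
  ext x
  constructor
  · rintro ⟨i, rfl⟩
    exact hfin.mem_toFinset.1 (g i).2
  · intro hx
    exact ⟨g.symm ⟨x, by simpa using hx⟩, by simp⟩

theorem skew_triple_extends_to_quadric_configuration {k : Type*} [Field k] [IsAlgClosed k]
    (d : ℕ) (hd : 3 ≤ d)
    (f : MvPolynomial (Fin 4) k) (hf : IsSmoothSurface f d)
    (hcount : {W : Submodule k (Fin 4 → k) | IsLineOn f W}.ncard =
      d ^ 2 * (d ^ 2 - 3 * d + 3))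
    (L₁ L₂ L₃ : Submodule k (Fin 4 → k))
    (h1 : IsLineOn f L₁) (h2 : IsLineOn f L₂) (h3 : IsLineOn f L₃)
    (h12 : L₁ ≠ L₂) (h13 : L₁ ≠ L₃) (h23 : L₂ ≠ L₃)
    (s12 : L₁ ⊓ L₂ = ⊥) (s13 : L₁ ⊓ L₃ = ⊥) (s23 : L₂ ⊓ L₃ = ⊥) :
    ∃ L M : Fin d → Submodule k (Fin 4 → k),
      L ⟨0, by omega⟩ = L₁ ∧ L ⟨1, by omega⟩ = L₂ ∧ L ⟨2, by omega⟩ = L₃ ∧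
      (∀ i, IsLineOn f (L i)) ∧ (∀ j, IsLineOn f (M j)) ∧
      (∀ i j, i ≠ j → L i ≠ L j ∧ L i ⊓ L j = ⊥) ∧
      (∀ i j, i ≠ j → M i ≠ M j ∧ M i ⊓ M j = ⊥) ∧
      (∀ i j, L i ≠ M j ∧ L i ⊓ M j ≠ ⊥) ∧
      (∀ N : Submodule k (Fin 4 → k), IsLineOn f N →
        (N ≠ L₁ ∧ N ⊓ L₁ ≠ ⊥) → (N ≠ L₂ ∧ N ⊓ L₂ ≠ ⊥) → (N ≠ L₃ ∧ N ⊓ L₃ ≠ ⊥) →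
        ∃ j, N = M j) := by
  have : Infinite k := IsAlgClosed.instInfinite
  have hM := ncard_common_transversals hd hf hcount h1 h2 h3 h12 h13 h23 s12 s13 s23
  obtain ⟨A, hA, B, hB, C, hC, hAB, hAC, hBC⟩ := (Set.two_lt_ncard (Set.finite_of_ncard_ne_zero
    (by omega))).1 (hM ▸ (by omega : 2 < d))
  obtain ⟨M, hMinj, hMrange, -, -, -⟩ := exists_enumeration hd _ hM hA hB hC hAB hAC hBC
  have hMmem : ∀ j, IsLineOn f (M j) ∧ M j ⊓ L₁ ≠ ⊥ ∧ M j ⊓ L₂ ≠ ⊥ ∧ M j ⊓ L₃ ≠ ⊥ := fun j ↦ by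
    have := Set.mem_range_self (f := M) j
    rwa [hMrange] at this
  have hMskew : ∀ i j, i ≠ j → M i ≠ M j ∧ M i ⊓ M j = ⊥ := by
    intro i j hij
    refine ⟨hMinj.ne hij, ?_⟩
    have hi := hMmem i
    have hj := hMmem j
    refine hf.inf_eq_bot_of_transversals h1 h2 hi.1 hj.1 s12 (hMinj.ne hij) ?_ ?_ ?_ ?_
    all_goals rw [inf_comm]
    exacts [hi.2.1, hi.2.2.1, hj.2.1, hj.2.2.1]
  obtain ⟨i₀, hi₀⟩ : ∃ i : Fin d, i = ⟨0, by omega⟩ := ⟨_, rfl⟩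
  obtain ⟨i₁, hi₁⟩ : ∃ i : Fin d, i = ⟨1, by omega⟩ := ⟨_, rfl⟩
  obtain ⟨i₂, hi₂⟩ : ∃ i : Fin d, i = ⟨2, by omega⟩ := ⟨_, rfl⟩
  obtain ⟨e01, t01⟩ := hMskew i₀ i₁ (by simp [hi₀, hi₁])
  obtain ⟨e02, t02⟩ := hMskew i₀ i₂ (by simp [hi₀, hi₂])
  obtain ⟨e12, t12⟩ := hMskew i₁ i₂ (by simp [hi₁, hi₂])
  obtain ⟨m₀, m₀₁, m₀₂, m₀₃⟩ := hMmem i₀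
  obtain ⟨m₁, m₁₁, m₁₂, m₁₃⟩ := hMmem i₁
  obtain ⟨m₂, m₂₁, m₂₂, m₂₃⟩ := hMmem i₂
  have hL := ncard_common_transversals hd hf hcount m₀ m₁ m₂ e01 e02 e12 t01 t02 t12
  obtain ⟨L, hLinj, hLrange, hL₁, hL₂, hL₃⟩ := exists_enumeration hd _ hL
    (a := L₁) (b := L₂) (c := L₃)
    ⟨h1, inf_comm L₁ _ ▸ m₀₁, inf_comm L₁ _ ▸ m₁₁, inf_comm L₁ _ ▸ m₂₁⟩
    ⟨h2, inf_comm L₂ _ ▸ m₀₂, inf_comm L₂ _ ▸ m₁₂, inf_comm L₂ _ ▸ m₂₂⟩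
    ⟨h3, inf_comm L₃ _ ▸ m₀₃, inf_comm L₃ _ ▸ m₁₃, inf_comm L₃ _ ▸ m₂₃⟩ h12 h13 h23
  have hLmem : ∀ i, IsLineOn f (L i) ∧ L i ⊓ M i₀ ≠ ⊥ ∧ L i ⊓ M i₁ ≠ ⊥ ∧ L i ⊓ M i₂ ≠ ⊥ :=
    fun i ↦ by
      have := Set.mem_range_self (f := L) i
      rwa [hLrange] at this
  have hmeet : ∀ i j, L i ⊓ M j ≠ ⊥ := fun i j ↦ by
    obtain ⟨n, n₁, n₂, n₃⟩ := hMmem j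
    obtain ⟨l, l₁, l₂, l₃⟩ := hLmem i
    exact inf_ne_bot_of_transversals h1.1 h2.1 h3.1 m₀.1 m₁.1 m₂.1 l.1 n.1 s12 s13 s23 t01 t02 t12
      m₀₁ m₀₂ m₀₃ m₁₁ m₁₂ m₁₃ m₂₁ m₂₂ m₂₃ n₁ n₂ n₃ l₁ l₂ l₃
  refine ⟨L, M, hL₁, hL₂, hL₃, fun i ↦ (hLmem i).1, fun j ↦ (hMmem j).1, fun i j hij ↦ ?_, hMskew,
    fun i j ↦ ⟨fun h ↦ ?_, hmeet i j⟩, fun N hN g₁ g₂ g₃ ↦ ?_⟩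
  · refine ⟨hLinj.ne hij, ?_⟩
    have hi := hLmem i
    have hj := hLmem j
    refine hf.inf_eq_bot_of_transversals m₀ m₁ hi.1 hj.1 t01 (hLinj.ne hij) ?_ ?_ ?_ ?_
    all_goals rw [inf_comm]
    exacts [hi.2.1, hi.2.2.1, hj.2.1, hj.2.2.1]
  · have : Nontrivial (Fin d) := Fin.nontrivial_iff_two_le.2 (by omega)
    obtain ⟨j', hj'⟩ := exists_ne j
    exact hmeet i j' (h ▸ (hMskew j j' hj'.symm).2)
  · have : N ∈ Set.range M := hMrange ▸ ⟨hN, g₁.2, g₂.2, g₃.2⟩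
    obtain ⟨j, hj⟩ := this
    exact ⟨j, hj.symm⟩
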